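/- arXiv:1004.1071 — 8 statements merged into one kernel-verified Lean document; each statement's English description precedes it below -/
import Mathlib

section
/- Let T > 0 and let f : [0,T] → ℝ be a continuous function of bounded variation. Then f*(T) = f(0) + μ_f({t ∈ (0,T] : f*(t) = f(t)}), i.e. the running maximum satisfies the integral representation f*(T) = f(0) + ∫₀ᵀ 1_{{f*(t)=f(t)}} dμ_f(t). -/
open MeasureTheory

open Set Filter Topology in
lemma aux_Ioo (T : ℝ) (f : ℝ → ℝ)
    (hf_cont : ContinuousOn f (Set.Icc 0 T))
    (μf : MeasureTheory.SignedMeasure ℝ)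
    (hμf : ∀ a b : ℝ, 0 ≤ a → a ≤ b → b ≤ T → μf (Set.Ioc a b) = f b - f a)
    (a b : ℝ) (ha : 0 ≤ a) (hab : a < b) (hb : b ≤ T) : μf (Ioo a b) = f b - f a := by
  obtain ⟨u, hu, hub, hlim⟩ := exists_seq_strictMono_tendsto' hab
  have hU : Ioo a b = ⋃ n, Ioc a (u n) := by
    ext x
    simp only [mem_iUnion, mem_Ioc, mem_Ioo]
    constructor
    · rintro ⟨h1, h2⟩
      obtain ⟨n, hn⟩ := (hlim.eventually (lt_mem_nhds h2)).exists
      exact ⟨n, h1, hn.le⟩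
    · rintro ⟨n, h1, h2⟩
      exact ⟨h1, h2.trans_lt (hub n).2⟩
  have h1 : Tendsto (fun n => μf (Ioc a (u n))) atTop (𝓝 (μf (⋃ n, Ioc a (u n)))) :=
    VectorMeasure.tendsto_vectorMeasure_iUnion_atTop_nat
      (fun i j hij => Ioc_subset_Ioc_right (hu.monotone hij)) (fun i => measurableSet_Ioc)
  have h2 : Tendsto (fun n => f (u n)) atTop (𝓝 (f b)) := by
    have hc := hf_cont b ⟨by linarith, hb⟩
    refine hc.tendsto.comp (tendsto_nhdsWithin_iff.2 ⟨hlim, Eventually.of_forall fun n => ?_⟩)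
    exact ⟨by linarith [(hub n).1], by linarith [(hub n).2]⟩
  have h3 : ∀ n, μf (Ioc a (u n)) = f (u n) - f a := fun n =>
    hμf _ _ ha (hub n).1.le (by linarith [(hub n).2])
  simp only [h3] at h1
  rw [hU]
  exact tendsto_nhds_unique h1 (h2.sub_const _)

open Set Filter Topology in
lemma aux_gap (μ : SignedMeasure ℝ) (C : Set ℝ) (P : Set (ℝ × ℝ))
    (hP : ∀ p ∈ P, p.1 < p.2 ∧ p.1 ∈ C ∧ p.2 ∈ C ∧ ∀ x ∈ Ioo p.1 p.2, x ∉ C)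
    (h0 : ∀ p ∈ P, μ (Ioo p.1 p.2) = 0) :
    MeasurableSet (⋃ p ∈ P, Ioo p.1 p.2) ∧ μ (⋃ p ∈ P, Ioo p.1 p.2) = 0 := by
  refine ⟨(isOpen_biUnion fun p _ => isOpen_Ioo).measurableSet, ?_⟩
  have hd : P.PairwiseDisjoint (fun p : ℝ × ℝ => Ioo p.1 p.2) := by
    intro p hp q hq hpq
    refine Set.disjoint_left.2 fun x hx hy => hpq ?_
    obtain ⟨-, p1, p2, p3⟩ := hP p hp
    obtain ⟨-, q1, q2, q3⟩ := hP q hq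
    have a1 := p3 q.1
    have a2 := p3 q.2
    have a3 := q3 p.1
    have a4 := q3 p.2
    simp only [mem_Ioo] at *
    ext
    · rcases lt_trichotomy p.1 q.1 with h | h | h
      · exact absurd q1 (a1 ⟨h, by linarith⟩)
      · exact h
      · exact absurd p1 (a3 ⟨h, by linarith⟩)
    · rcases lt_trichotomy p.2 q.2 with h | h | h
      · exact absurd p2 (a4 ⟨by linarith, h⟩)
      · exact h
      · exact absurd q2 (a2 ⟨by linarith, h⟩)
  have hc : P.Countable := hd.countable_of_isOpen (fun p _ => isOpen_Ioo)
    (fun p hp => nonempty_Ioo.2 (hP p hp).1)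
  rw [VectorMeasure.of_biUnion hc hd (fun p _ => measurableSet_Ioo)]
  simp [fun p : P => h0 p p.2]

open Set Filter Topology

/-- Let `T > 0` and let `f : [0,T] → ℝ` be a continuous function of bounded
variation, with running maximum `f*(t) = max_{0 ≤ s ≤ t} f(s)` and induced Lebesgue–Stieltjes
signed measure `μ_f` (characterized by `μ_f((a,b]) = f(b) - f(a)` for `0 ≤ a ≤ b ≤ T`).
Then `f*(T) = f(0) + μ_f({t ∈ (0,T] : f*(t) = f(t)})`. -/
theorem maximum_representation_of_continuous_BV
    (T : ℝ) (hT : 0 < T) (f : ℝ → ℝ)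
    (hf_cont : ContinuousOn f (Set.Icc 0 T))
    (hf_bv : BoundedVariationOn f (Set.Icc 0 T))
    (fstar : ℝ → ℝ)
    (hfstar : ∀ t ∈ Set.Icc (0:ℝ) T, IsGreatest (f '' Set.Icc 0 t) (fstar t))
    (μf : MeasureTheory.SignedMeasure ℝ)
    (hμf : ∀ a b : ℝ, 0 ≤ a → a ≤ b → b ≤ T → μf (Set.Ioc a b) = f b - f a) :
    fstar T = f 0 + μf {t | t ∈ Set.Ioc 0 T ∧ fstar t = f t} := by
  classical
  set C : Set ℝ := {t | t ∈ Icc 0 T ∧ ∀ s ∈ Icc 0 t, f s ≤ f t} with hC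
  have hCs : C ⊆ Icc 0 T := fun t h => h.1
  have hCf : ∀ t ∈ Icc (0:ℝ) T, (fstar t = f t ↔ t ∈ C) := by
    intro t ht
    obtain ⟨h1, h2⟩ := hfstar t ht
    constructor
    · intro h
      exact ⟨ht, fun s hs => h ▸ h2 (mem_image_of_mem f hs)⟩
    · rintro ⟨-, h⟩
      obtain ⟨s, hs, hs'⟩ := h1
      exact le_antisymm (hs' ▸ h s hs) (h2 (mem_image_of_mem f ⟨ht.1, le_rfl⟩))
  have hcl : IsClosed C := by
    refine isClosed_of_closure_subset fun t ht => ?_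
    have htI : t ∈ Icc 0 T := closure_minimal hCs isClosed_Icc ht
    refine ⟨htI, fun s hs => ?_⟩
    by_contra! hlt
    have hst : s < t := lt_of_le_of_ne hs.2 (by rintro rfl; exact lt_irrefl _ hlt)
    have e1 : ∀ᶠ r in 𝓝[C] t, f r < f s :=
      ((hf_cont t htI).mono hCs).eventually (gt_mem_nhds hlt)
    have e2 : ∀ᶠ r in 𝓝[C] t, s < r := nhdsWithin_le_nhds (lt_mem_nhds hst)
    have : (𝓝[C] t).NeBot := mem_closure_iff_nhdsWithin_neBot.1 ht
    obtain ⟨r, ⟨h1, h2⟩, h3⟩ := ((e1.and e2).and self_mem_nhdsWithin).exists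
    exact absurd (h3.2 s ⟨hs.1, h2.le⟩) (not_le.2 h1)
  have hcomp : IsCompact C := isCompact_Icc.of_isClosed_subset hcl hCs
  have h0C : (0:ℝ) ∈ C := ⟨⟨le_rfl, hT.le⟩, fun s hs => by
    rw [le_antisymm hs.2 hs.1]⟩
  obtain ⟨L, hLC, hLub⟩ := hcomp.exists_isGreatest ⟨0, h0C⟩
  have hL : fstar T = f L := by
    obtain ⟨⟨r, hr, hrT⟩, h2⟩ := hfstar T ⟨hT.le, le_rfl⟩
    have hrC : r ∈ C := ⟨hr, fun s hs => by
      rw [hrT]; exact h2 (mem_image_of_mem f ⟨hs.1, hs.2.trans hr.2⟩)⟩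
    refine le_antisymm ?_ (h2 (mem_image_of_mem f hLC.1))
    rw [← hrT]
    exact hLC.2 r ⟨hr.1, hLub hrC⟩
  set P : Set (ℝ × ℝ) :=
    {p | p.1 < p.2 ∧ p.1 ∈ C ∧ p.2 ∈ C ∧ ∀ x ∈ Ioo p.1 p.2, x ∉ C} with hPdef
  have hP0 : ∀ p ∈ P, μf (Ioo p.1 p.2) = 0 := by
    rintro ⟨a, b⟩ ⟨hab, ha, hb, hg⟩
    simp only at hab ha hb hg ⊢
    rw [aux_Ioo T f hf_cont μf hμf a b ha.1.1 hab hb.1.2]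
    have hle : f a ≤ f b := hb.2 a ⟨ha.1.1, hab.le⟩
    by_contra hne
    have hlt : f a < f b := lt_of_le_of_ne hle (fun h => hne (by rw [h]; ring))
    have hsub : Icc a b ⊆ Icc 0 T := Icc_subset_Icc ha.1.1 hb.1.2
    have hcab := hf_cont.mono hsub
    obtain ⟨c, hc1, hc2⟩ := exists_between hlt
    obtain ⟨x, hx, hxc⟩ := intermediate_value_Ioo hab.le hcab ⟨hc1, hc2⟩
    have hK : IsCompact (Icc a b ∩ f ⁻¹' Ici c) :=
      isCompact_Icc.of_isClosed_subset (hcab.preimage_isClosed_of_isClosed isClosed_Icc isClosed_Ici)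
        inter_subset_left
    obtain ⟨r, ⟨hr1, hr2⟩, hr3⟩ := hK.exists_isLeast ⟨x, ⟨hx.1.le, hx.2.le⟩, hxc.ge⟩
    have hrx : r ≤ x := hr3 ⟨⟨hx.1.le, hx.2.le⟩, hxc.ge⟩
    have hr2 : c ≤ f r := hr2
    have har : a < r := lt_of_le_of_ne hr1.1 (by rintro rfl; linarith)
    refine hg r ⟨har, hrx.trans_lt hx.2⟩ ⟨hsub hr1, fun s hs => ?_⟩
    by_contra! h
    rcases le_total s a with hsa | hsa
    · linarith [ha.2 s ⟨hs.1, hsa⟩]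
    · have : r ≤ s := hr3 ⟨⟨hsa, hs.2.trans hr1.2⟩, by show c ≤ f s; linarith⟩
      rw [le_antisymm this hs.2] at h
      exact lt_irrefl _ h
  obtain ⟨hVm, hV0⟩ := aux_gap μf C P (fun p hp => hp) hP0
  have hA : {t | t ∈ Ioc 0 T ∧ fstar t = f t} = C ∩ Ioc 0 T := by
    ext t
    constructor
    · rintro ⟨h1, h2⟩
      exact ⟨(hCf t ⟨h1.1.le, h1.2⟩).1 h2, h1⟩
    · rintro ⟨h1, h2⟩
      exact ⟨h2, (hCf t ⟨h2.1.le, h2.2⟩).2 h1⟩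
  have hun : Ioc 0 L = (C ∩ Ioc 0 T) ∪ ⋃ p ∈ P, Ioo p.1 p.2 := by
    ext t
    simp only [mem_union, mem_iUnion, exists_prop]
    constructor
    · rintro ⟨h1, h2⟩
      by_cases htC : t ∈ C
      · exact Or.inl ⟨htC, h1, htC.1.2⟩
      · right
        obtain ⟨a, ha, ha'⟩ := (hcomp.inter_right isClosed_Iic).exists_isGreatest
          (⟨0, h0C, h1.le⟩ : (C ∩ Iic t).Nonempty)
        obtain ⟨b, hb, hb'⟩ := (hcomp.inter_right isClosed_Ici).exists_isLeast
          (⟨L, hLC, h2⟩ : (C ∩ Ici t).Nonempty)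
        have hat : a < t := lt_of_le_of_ne ha.2 (by rintro rfl; exact htC ha.1)
        have hbt : t < b := lt_of_le_of_ne hb.2 (by rintro rfl; exact htC hb.1)
        refine ⟨(a, b), ⟨hat.trans hbt, ha.1, hb.1, fun x hx hxC => ?_⟩, hat, hbt⟩
        rcases le_total x t with h | h
        · exact absurd (ha' ⟨hxC, h⟩) (not_le.2 hx.1)
        · exact absurd (hb' ⟨hxC, h⟩) (not_le.2 hx.2)
    · rintro (⟨h1, h2⟩ | ⟨p, hp, hx⟩)
      · exact ⟨h2.1, hLub h1⟩
      · exact ⟨lt_of_le_of_lt hp.2.1.1.1 hx.1, hx.2.le.trans (hLub hp.2.2.1)⟩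
  have hdis : Disjoint (C ∩ Ioc 0 T) (⋃ p ∈ P, Ioo p.1 p.2) := by
    refine Set.disjoint_left.2 fun x hx hx' => ?_
    simp only [mem_iUnion, exists_prop] at hx'
    obtain ⟨p, hp, h⟩ := hx'
    exact hp.2.2.2 x h hx.1
  have hfin := hμf 0 L le_rfl hLC.1.1 hLC.1.2
  rw [hun, VectorMeasure.of_union hdis (hcl.measurableSet.inter measurableSet_Ioc) hVm, hV0] at hfin
  rw [hA, hL]
  linarith
end

section
/- Let T > 0, let f : [0,T] → ℝ be a continuous function of bounded variation, and set E = {t ∈ [0,T] : f*(t) = f(t)}. Then μ_{f*}(Eᶜ) = 0, where Eᶜ = [0,T] \ E. -/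
open MeasureTheory

lemma signed_null_of_Ioc (s : SignedMeasure ℝ) (p q : ℝ)
    (h : ∀ a b : ℝ, p ≤ a → a ≤ b → b ≤ q → s (Set.Ioc a b) = 0)
    {A : Set ℝ} (hA : MeasurableSet A) (hAs : A ⊆ Set.Ioc p q) : s A = 0 := by
  set j := s.toJordanDecomposition with hj
  have key : ∀ B : Set ℝ, MeasurableSet B → s B = j.posPart.real B - j.negPart.real B := by
    intro B hB
    conv_lhs => rw [← s.toSignedMeasure_toJordanDecomposition]
    rw [JordanDecomposition.toSignedMeasure, Measure.toSignedMeasure_sub_apply hB]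
  have hm : j.posPart.restrict (Set.Ioc p q) = j.negPart.restrict (Set.Ioc p q) := by
    apply Measure.ext_of_Ioc
    intro a b hab
    rw [Measure.restrict_apply measurableSet_Ioc, Measure.restrict_apply measurableSet_Ioc,
      Set.Ioc_inter_Ioc]
    rcases le_total (a ⊔ p) (b ⊓ q) with hle | hle
    · have h1 := h (a ⊔ p) (b ⊓ q) le_sup_right hle inf_le_right
      rw [key _ measurableSet_Ioc, sub_eq_zero] at h1
      exact (measureReal_eq_measureReal_iff).1 h1
    · rw [Set.Ioc_eq_empty (not_lt.2 hle)]; simp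
  have h2 : j.posPart A = j.negPart A := by
    have := congrArg (fun m => m A) hm
    simpa [Measure.restrict_apply hA, Set.inter_eq_left.2 hAs] using this
  rw [key A hA, measureReal_def, measureReal_def, h2, sub_self]

/-- Let `T > 0`, let `f : [0,T] → ℝ` be a continuous function of bounded
variation with running maximum `f*`, and set `E = {t ∈ [0,T] : f*(t) = f(t)}`.  Then the
Lebesgue–Stieltjes measure `μ_{f*}` induced by `f*` (characterized by
`μ_{f*}((a,b]) = f*(b) - f*(a)` for `0 ≤ a ≤ b ≤ T`) vanishes on `Eᶜ = [0,T] \ E`. -/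
theorem running_max_measure_vanishes_off_contact_set
    (T : ℝ) (hT : 0 < T) (f : ℝ → ℝ)
    (hf_cont : ContinuousOn f (Set.Icc 0 T))
    (hf_bv : BoundedVariationOn f (Set.Icc 0 T))
    (fstar : ℝ → ℝ)
    (hfstar : ∀ t ∈ Set.Icc (0:ℝ) T, IsGreatest (f '' Set.Icc 0 t) (fstar t))
    (μfstar : MeasureTheory.SignedMeasure ℝ)
    (hμfstar : ∀ a b : ℝ, 0 ≤ a → a ≤ b → b ≤ T →
      μfstar (Set.Ioc a b) = fstar b - fstar a) :
    μfstar (Set.Icc 0 T \ {t | t ∈ Set.Icc 0 T ∧ fstar t = f t}) = 0 := by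
  have mono : ∀ a b : ℝ, 0 ≤ a → a ≤ b → b ≤ T → fstar a ≤ fstar b := by
    intro a b ha hab hb
    obtain ⟨⟨x, hx, hxe⟩, -⟩ := hfstar a ⟨ha, hab.trans hb⟩
    rw [← hxe]
    exact (hfstar b ⟨ha.trans hab, hb⟩).2 ⟨x, ⟨hx.1, hx.2.trans hab⟩, rfl⟩
  let ι := {x : ℚ × ℚ // 0 ≤ (x.1 : ℝ) ∧ fstar x.1 = fstar (min (x.2 : ℝ) T)}
  let F : ι → Set ℝ := fun x => Set.Ioc (x.1.1 : ℝ) (min (x.1.2 : ℝ) T)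
  have hFm : ∀ x, MeasurableSet (F x) := fun x => measurableSet_Ioc
  have hnull : ∀ x, ∀ A, MeasurableSet A → A ⊆ F x → μfstar A = 0 := by
    rintro ⟨⟨p, q⟩, hp, hpq⟩ A hA hAs
    refine signed_null_of_Ioc μfstar p (min (q : ℝ) T) ?_ hA hAs
    intro a b hpa hab hbq
    have hbT : b ≤ T := hbq.trans (min_le_right _ _)
    rw [hμfstar a b (hp.trans hpa) hab hbT]
    have h1 := mono p a hp hpa (hab.trans hbT)
    have h2 := mono a b (hp.trans hpa) hab hbT
    have h3 := mono b (min (q : ℝ) T) ((hp.trans hpa).trans hab) hbq (min_le_right _ _)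
    simp only at hpq
    linarith
  have hU : MeasurableSet (⋃ x, F x) := MeasurableSet.iUnion hFm
  have hle : μfstar ≤[⋃ x, F x] 0 :=
    VectorMeasure.restrict_le_restrict_countable_iUnion _ _ hFm fun x =>
      VectorMeasure.restrict_le_restrict_of_subset_le _ _ fun A hA hAs => by
        rw [hnull x A hA hAs]; simp
  have hge : 0 ≤[⋃ x, F x] μfstar :=
    VectorMeasure.restrict_le_restrict_countable_iUnion _ _ hFm fun x =>
      VectorMeasure.restrict_le_restrict_of_subset_le _ _ fun A hA hAs => by
        rw [hnull x A hA hAs]; simp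
  have hsub : Set.Icc 0 T \ {t | t ∈ Set.Icc 0 T ∧ fstar t = f t} ⊆ ⋃ x, F x := by
    rintro t ⟨ht, hne⟩
    have hne' : fstar t ≠ f t := fun h => hne ⟨ht, h⟩
    have hlt : f t < fstar t :=
      lt_of_le_of_ne ((hfstar t ht).2 ⟨t, ⟨ht.1, le_rfl⟩, rfl⟩) hne'.symm
    have ht0 : 0 < t := by
      rcases ht.1.lt_or_eq with h | h
      · exact h
      · exfalso
        obtain ⟨⟨x, hx, hxe⟩, -⟩ := hfstar t ht
        have : x = t := le_antisymm hx.2 (h ▸ hx.1)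
        rw [this] at hxe
        exact hne' hxe.symm
    have hev := (hf_cont t ht).eventually (gt_mem_nhds hlt)
    rw [eventually_nhdsWithin_iff, Metric.eventually_nhds_iff] at hev
    obtain ⟨δ, hδ, hb⟩ := hev
    have hb' : ∀ y, 0 ≤ y → y ≤ T → t - δ < y → y < t + δ → f y < fstar t := by
      intro y h0 h1 h2 h3
      refine hb ?_ ⟨h0, h1⟩
      rw [Real.dist_eq, abs_lt]; constructor <;> linarith
    obtain ⟨p, hp1, hp2⟩ := exists_rat_btwn (max_lt ht0 (sub_lt_self t hδ))
    obtain ⟨q, hq1, hq2⟩ := exists_rat_btwn (lt_add_of_pos_right t hδ)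
    have hp0 : (0 : ℝ) < p := (le_max_left _ _).trans_lt hp1
    have hpd : t - δ < p := (le_max_right _ _).trans_lt hp1
    have htm : t ≤ min (q : ℝ) T := le_min hq1.le ht.2
    have hmT : min (q : ℝ) T ≤ T := min_le_right _ _
    have hmq : min (q : ℝ) T ≤ q := min_le_left _ _
    have hpm : (p : ℝ) ≤ min (q : ℝ) T := hp2.le.trans htm
    have hpT : (p : ℝ) ≤ T := hpm.trans hmT
    refine Set.mem_iUnion.2 ⟨⟨(p, q), hp0.le, ?_⟩, hp2, htm⟩
    refine le_antisymm (mono _ _ hp0.le hpm hmT) ?_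
    obtain ⟨⟨x, hx, hxe⟩, -⟩ := hfstar (min (q : ℝ) T) ⟨hp0.le.trans hpm, hmT⟩
    rw [← hxe]
    rcases le_or_gt x p with hxp | hxp
    · exact (hfstar p ⟨hp0.le, hpT⟩).2 ⟨x, ⟨hx.1, hxp⟩, rfl⟩
    · have h1 := hb' x hx.1 (hx.2.trans hmT) (hpd.trans hxp) ((hx.2.trans hmq).trans_lt hq2)
      have h2 := mono t _ ht0.le htm hmT
      linarith
  refine le_antisymm ?_ ?_
  · simpa using VectorMeasure.subset_le_of_restrict_le_restrict _ _ hU hle hsub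
  · simpa using VectorMeasure.subset_le_of_restrict_le_restrict _ _ hU hge hsub
end

section
/- Let T > 0 and let f : [0,T] → ℝ be an absolutely continuous function (hence of bounded variation). Then f*(T) = f(0) + ∫_{E} f'(t) dt, where E = {t ∈ [0,T] : f*(t) = f(t)} and f' denotes the almost-everywhere defined derivative of f; equivalently, f*(T) = f(0) + ∫₀ᵀ 1_{{f*(t)=f(t)}} dμ_f(t). -/
open MeasureTheory

/-- A function `f` is absolutely continuous on `[0,T]` if for every `ε > 0` there is `δ > 0`
such that for every finite collection of pairwise disjoint subintervals `(aᵢ, bᵢ)` of `[0,T]`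
of total length less than `δ` one has `Σᵢ |f(bᵢ) - f(aᵢ)| < ε`. -/
def AbsolutelyContinuousOnIcc (f : ℝ → ℝ) (T : ℝ) : Prop :=
  ∀ ε > (0:ℝ), ∃ δ > (0:ℝ), ∀ (n : ℕ) (a b : Fin n → ℝ),
    (∀ i, 0 ≤ a i ∧ a i ≤ b i ∧ b i ≤ T) →
    (Pairwise fun i j => Disjoint (Set.Ioo (a i) (b i)) (Set.Ioo (a j) (b j))) →
    (∑ i, (b i - a i)) < δ → (∑ i, |f (b i) - f (a i)|) < ε

lemma acIcc_to_interval {f : ℝ → ℝ} {T : ℝ} (hT : 0 < T) (hf : AbsolutelyContinuousOnIcc f T) :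
    AbsolutelyContinuousOnInterval f 0 T := by
  rw [absolutelyContinuousOnInterval_iff]
  intro ε hε
  obtain ⟨δ, hδ, h⟩ := hf ε hε
  refine ⟨δ, hδ, ?_⟩
  rintro ⟨n, I⟩ ⟨h1, h2⟩ h3
  simp only [Set.uIcc_of_le hT.le, Finset.mem_range, Set.mem_Icc] at h1 h2 h3 ⊢
  have := h n (fun i => min (I i).1 (I i).2) (fun i => max (I i).1 (I i).2) ?_ ?_ ?_
  · rw [Finset.sum_range]
    refine lt_of_eq_of_lt ?_ this
    refine Finset.sum_congr rfl fun i _ => ?_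
    rw [Real.dist_eq]
    rcases le_total (I i).1 (I i).2 with hh | hh
    · rw [min_eq_left hh, max_eq_right hh, abs_sub_comm]
    · rw [min_eq_right hh, max_eq_left hh]
  · intro i
    obtain ⟨⟨a1, a2⟩, b1, b2⟩ := h1 i i.2
    exact ⟨le_min a1 b1, min_le_max, max_le a2 b2⟩
  · intro i j hij
    have := h2 (x := (i : ℕ)) (by simp) (y := (j : ℕ)) (by simp) (fun h => hij (Fin.ext h))
    exact Disjoint.mono Set.Ioo_subset_Ioc_self Set.Ioo_subset_Ioc_self this
  · rw [Finset.sum_range] at h3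
    refine lt_of_eq_of_lt ?_ h3
    refine Finset.sum_congr rfl fun i _ => ?_
    rw [Real.dist_eq, max_sub_min_eq_abs']

lemma acIcc_of_choice {f g : ℝ → ℝ} {T : ℝ} (hf : AbsolutelyContinuousOnIcc f T)
    (h : ∀ a b, 0 ≤ a → a ≤ b → b ≤ T → ∃ c, a ≤ c ∧ c ≤ b ∧ |g b - g a| ≤ |f c - f a|) :
    AbsolutelyContinuousOnIcc g T := by
  intro ε hε
  obtain ⟨δ, hδ, H⟩ := hf ε hε
  refine ⟨δ, hδ, fun n a b h1 h2 h3 => ?_⟩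
  choose c hc1 hc2 hc3 using fun i => h (a i) (b i) (h1 i).1 (h1 i).2.1 (h1 i).2.2
  refine lt_of_le_of_lt (Finset.sum_le_sum fun i _ => hc3 i) (H n a c ?_ ?_ ?_)
  · exact fun i => ⟨(h1 i).1, hc1 i, (hc2 i).trans (h1 i).2.2⟩
  · exact fun i j hij => (h2 hij).mono (Set.Ioo_subset_Ioo_right (hc2 i))
      (Set.Ioo_subset_Ioo_right (hc2 j))
  · refine lt_of_le_of_lt (Finset.sum_le_sum fun i _ => ?_) h3
    linarith [hc2 i]

/-- Let `T > 0` and let `f : [0,T] → ℝ` be absolutely continuous (hence of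
bounded variation), with almost-everywhere defined derivative `f'`.  Then
`f*(T) = f(0) + ∫_E f'(t) dt`, where `E = {t ∈ [0,T] : f*(t) = f(t)}` and `f*` is the running
maximum of `f`; equivalently `f*(T) = f(0) + ∫₀ᵀ 1_{{f*(t) = f(t)}} dμ_f(t)`. -/
theorem maximum_representation_of_absolutely_continuous
    (T : ℝ) (hT : 0 < T) (f : ℝ → ℝ)
    (hf : AbsolutelyContinuousOnIcc f T)
    (f' : ℝ → ℝ)
    (hf' : ∀ᵐ t ∂(volume.restrict (Set.Icc (0:ℝ) T)),
      HasDerivWithinAt f (f' t) (Set.Icc 0 T) t)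
    (fstar : ℝ → ℝ)
    (hfstar : ∀ t ∈ Set.Icc (0:ℝ) T, IsGreatest (f '' Set.Icc 0 t) (fstar t)) :
    fstar T = f 0 + ∫ t in {t | t ∈ Set.Icc 0 T ∧ fstar t = f t}, f' t := by
  have hle : ∀ t, 0 ≤ t → t ≤ T → ∀ s, 0 ≤ s → s ≤ t → f s ≤ fstar t := fun t h0 h1 s hs hst =>
    (hfstar t ⟨h0, h1⟩).2 ⟨s, ⟨hs, hst⟩, rfl⟩
  have hex : ∀ t, 0 ≤ t → t ≤ T → ∃ s, 0 ≤ s ∧ s ≤ t ∧ f s = fstar t := fun t h0 h1 => by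
    obtain ⟨s, hs, h⟩ := (hfstar t ⟨h0, h1⟩).1
    exact ⟨s, hs.1, hs.2, h⟩
  have hmono : ∀ a b, 0 ≤ a → a ≤ b → b ≤ T → fstar a ≤ fstar b := fun a b ha hab hb => by
    obtain ⟨s, h1, h2, h3⟩ := hex a ha (hab.trans hb)
    rw [← h3]
    exact hle b (ha.trans hab) hb s h1 (h2.trans hab)
  have hacs : AbsolutelyContinuousOnIcc fstar T := by
    refine acIcc_of_choice hf fun a b ha hab hb => ?_
    obtain ⟨s, h1, h2, h3⟩ := hex b (ha.trans hab) hb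
    have hm := hmono a b ha hab hb
    by_cases hs : s ≤ a
    · refine ⟨a, le_rfl, hab, ?_⟩
      have := hle a ha (hab.trans hb) s h1 hs
      have : fstar b - fstar a = 0 := by linarith
      rw [this]; simp
    · refine ⟨s, (not_le.1 hs).le, h2, ?_⟩
      have := hle a ha (hab.trans hb) a ha le_rfl
      rw [abs_of_nonneg (by linarith)]
      refine le_trans ?_ (le_abs_self _)
      linarith
  have hF := acIcc_to_interval hT hf
  have hS := acIcc_to_interval hT hacs
  have hFc : ContinuousOn f (Set.Icc 0 T) := by simpa [Set.uIcc_of_le hT.le] using hF.continuousOn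
  have hSc : ContinuousOn fstar (Set.Icc 0 T) := by
    simpa [Set.uIcc_of_le hT.le] using hS.continuousOn
  have h0 : fstar 0 = f 0 := by
    obtain ⟨s, h1, h2, h3⟩ := hex 0 le_rfl hT.le
    rw [← h3, le_antisymm h2 h1]
  set E : Set ℝ := {t | t ∈ Set.Icc 0 T ∧ fstar t = f t} with hE
  have hEcl : IsClosed E := by
    have := (hSc.sub hFc).preimage_isClosed_of_isClosed isClosed_Icc (isClosed_singleton (x := (0:ℝ)))
    convert this using 1
    ext t
    simp [hE, sub_eq_zero]
  have hEsub : E ⊆ Set.Icc 0 T := fun t ht => ht.1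
  have key : ∀ᵐ t, t ∈ Set.Ioc 0 T → deriv fstar t = E.indicator f' t := by
    rw [ae_restrict_iff' measurableSet_Icc] at hf'
    have hne : ∀ᵐ t : ℝ, t ≠ T := by simp [ae_iff]
    filter_upwards [hf', hS.ae_differentiableAt, hne] with t h1 h2 h3 h4
    have hI : t ∈ Set.Icc 0 T := ⟨h4.1.le, h4.2⟩
    have htT : t < T := lt_of_le_of_ne h4.2 h3
    have hn : Set.Icc 0 T ∈ nhds t := Icc_mem_nhds h4.1 htT
    have hd := (h1 hI).hasDerivAt hn
    have hs := (h2 (by rwa [Set.uIcc_of_le hT.le])).hasDerivAt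
    by_cases hEt : t ∈ E
    · rw [Set.indicator_of_mem hEt]
      have hmin : IsLocalMin (fun x => fstar x - f x) t := by
        filter_upwards [hn] with x hx
        have := hle x hx.1 hx.2 x hx.1 le_rfl
        have := hEt.2
        linarith
      have := hmin.hasDerivAt_eq_zero (hs.sub hd)
      linarith
    · rw [Set.indicator_of_notMem hEt]
      have hlt : f t < fstar t :=
        lt_of_le_of_ne (hle t hI.1 hI.2 t hI.1 le_rfl) fun h => hEt ⟨hI, h.symm⟩
      obtain ⟨m, hm1, hm2⟩ := exists_between hlt
      have e1 : ∀ᶠ x in nhds t, f x < m := (hFc.continuousAt hn).eventually (gt_mem_nhds hm1)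
      have e2 : ∀ᶠ x in nhds t, m < fstar x := (hSc.continuousAt hn).eventually (lt_mem_nhds hm2)
      obtain ⟨r, hr, hball⟩ := Metric.eventually_nhds_iff_ball.1 ((e1.and e2).and hn)
      have hconst : ∀ a b, a ∈ Metric.ball t r → b ∈ Metric.ball t r → a ≤ b →
          fstar a = fstar b := by
        intro a b ha hb hab
        have ⟨⟨a1, a2⟩, a3⟩ := hball a ha
        have ⟨⟨b1, b2⟩, b3⟩ := hball b hb
        refine le_antisymm (hmono a b a3.1 hab b3.2) ?_
        obtain ⟨s, s1, s2, s3⟩ := hex b b3.1 b3.2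
        rcases le_total s a with hsa | hsa
        · rw [← s3]; exact hle a a3.1 a3.2 s s1 hsa
        · have hsb : s ∈ Metric.ball t r := by
            rw [Real.ball_eq_Ioo] at *
            exact ⟨lt_of_lt_of_le ha.1 hsa, lt_of_le_of_lt s2 hb.2⟩
          have := (hball s hsb).1.1
          linarith
      have hev : fstar =ᶠ[nhds t] fun _ => fstar t := by
        filter_upwards [Metric.ball_mem_nhds t hr] with x hx
        rcases le_total x t with h | h
        · exact hconst x t hx (Metric.mem_ball_self hr) h
        · exact (hconst t x (Metric.mem_ball_self hr) hx h).symm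
      rw [hev.deriv_eq]; simp
  have hint := hS.integral_deriv_eq_sub
  rw [intervalIntegral.integral_of_le hT.le, setIntegral_congr_ae measurableSet_Ioc key,
    ← integral_Icc_eq_integral_Ioc, setIntegral_indicator hEcl.measurableSet,
    Set.inter_eq_self_of_subset_right hEsub, h0] at hint
  linarith
end

section
/- Let B be a fractional Brownian motion with Hurst index H ∈ (0,1) on [0,T] and let M_t = max_{0≤s≤t} B_s be its running maximum. Then for every t ∈ (0,T], P{M_t = 0} = 0. -/
open MeasureTheory

/-- The running maximum `M_t(ω) = max_{0 ≤ s ≤ t} B_s(ω)` of a real-valued process `B`. -/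
noncomputable def runningMax {Ω : Type*} (B : ℝ → Ω → ℝ) (t : ℝ) (ω : Ω) : ℝ :=
  sSup ((fun s => B s ω) '' Set.Icc 0 t)

/-- A fractional Brownian motion with Hurst index `H` on `[0,T]`: a (coordinatewise
measurable) process `B` with `B₀ = 0`, almost surely continuous sample paths, which is a
centered Gaussian process (every finite linear combination `Σ cᵢ B_{tᵢ}` is a centered
Gaussian random variable), and whose covariance is
`E[B_s B_t] = (1/2)(t^{2H} + s^{2H} - |t - s|^{2H})` for `s, t ∈ [0,T]`. -/
def IsFractionalBrownianMotion {Ω : Type*} [MeasurableSpace Ω] (P : Measure Ω)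
    (H T : ℝ) (B : ℝ → Ω → ℝ) : Prop :=
  (∀ ω, B 0 ω = 0) ∧
  (∀ t ∈ Set.Icc (0:ℝ) T, Measurable (B t)) ∧
  (∀ᵐ ω ∂P, ContinuousOn (fun t => B t ω) (Set.Icc 0 T)) ∧
  (∀ (n : ℕ) (c : Fin n → ℝ) (t : Fin n → ℝ), (∀ i, t i ∈ Set.Icc (0:ℝ) T) →
    ∃ v : NNReal, P.map (fun ω => ∑ i, c i * B (t i) ω) = ProbabilityTheory.gaussianReal 0 v) ∧
  (∀ s ∈ Set.Icc (0:ℝ) T, ∀ t ∈ Set.Icc (0:ℝ) T,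
    ∫ ω, B s ω * B t ω ∂P = (1/2) * (t ^ (2*H) + s ^ (2*H) - |t - s| ^ (2*H)))

open ProbabilityTheory in
lemma aux_gauss_small (ε : ℝ) (hε : 0 ≤ ε) :
    (gaussianReal 0 1).real (Set.Icc (-ε) ε) ≤ 2 * ε := by
  have h : gaussianReal 0 1 (Set.Icc (-ε) ε) ≤ ENNReal.ofReal (2 * ε) := by
    rw [gaussianReal_apply 0 one_ne_zero]
    calc ∫⁻ x in Set.Icc (-ε) ε, gaussianPDF 0 1 x
        ≤ ∫⁻ x in Set.Icc (-ε) ε, 1 := by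
          refine lintegral_mono fun x => ?_
          rw [gaussianPDF, gaussianPDFReal]
          refine ENNReal.ofReal_le_one.2 ?_
          have h1 : (√(2 * Real.pi * ((1 : NNReal) : ℝ)))⁻¹ ≤ 1 := by
            refine inv_le_one_of_one_le₀ ?_
            rw [Real.one_le_sqrt]
            have := Real.pi_gt_three
            simp; linarith
          have h2 : Real.exp (-(x - 0) ^ 2 / (2 * ((1 : NNReal) : ℝ))) ≤ 1 := by
            rw [Real.exp_le_one_iff]
            simp
            have := sq_nonneg x
            linarith
          exact mul_le_one₀ h1 (Real.exp_pos _).le h2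
      _ = ENNReal.ofReal (2 * ε) := by
          rw [setLIntegral_one, Real.volume_Icc]
          congr 1; ring
  exact ENNReal.toReal_le_of_le_ofReal (by positivity) h

open ProbabilityTheory in
lemma aux_key {Ω : Type*} [MeasurableSpace Ω] (P : Measure Ω) [IsProbabilityMeasure P]
    (X : ℕ → Ω → ℝ) (hX : ∀ n, Measurable (X n))
    (hlaw : ∀ n, P.map (X n) = gaussianReal 0 1) (A : Set Ω) (hA : MeasurableSet A)
    (hAX : ∀ n, ∀ ω ∈ A, X n ω ≤ 0) (p : ℝ) (hp : 0 < p) (hpA : p ≤ P.real A)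
    (hcov : ∀ m n, m ≠ n → ∫ ω, X m ω * X n ω ∂P ≤ (p ^ 2 / 8) ^ 2 / 2) : False := by
  set c := p ^ 2 / 8 with hc
  have hcpos : 0 < c := by positivity
  have hPA1 : P.real A ≤ 1 := measureReal_le_one
  have hL2 : ∀ n, MemLp (X n) 2 P := by
    intro n
    have h : MemLp id 2 (P.map (X n)) := by
      rw [hlaw n]; exact memLp_id_gaussianReal 2
    exact (memLp_map_measure_iff aestronglyMeasurable_id (hX n).aemeasurable).1 h
  have hvar : ∀ n, ∫ ω, X n ω * X n ω ∂P = 1 := by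
    intro n
    have h1 : ∫ x, x * x ∂(P.map (X n)) = ∫ ω, X n ω * X n ω ∂P :=
      integral_map (hX n).aemeasurable (by fun_prop)
    rw [← h1, hlaw n]
    have h2 := variance_eq_integral (μ := gaussianReal 0 1) (X := id) (by fun_prop)
    rw [variance_id_gaussianReal] at h2
    simp [integral_id_gaussianReal] at h2
    rw [h2]; simp [sq]
  set f : Ω → ℝ := A.indicator (fun _ => 1) with hf
  have hfL2 : MemLp f 2 P := (memLp_const 1).indicator hA
  have hff : ∫ ω, f ω * f ω ∂P = P.real A := by
    have : (fun ω => f ω * f ω) = A.indicator (fun _ => (1:ℝ)) := by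
      ext ω; by_cases h : ω ∈ A <;> simp [hf, h]
    rw [this, integral_indicator hA]; simp
  have hint : ∀ n, Integrable (fun ω => X n ω * f ω) P := fun n => (hL2 n).integrable_mul hfL2
  have hXf : ∀ n, ∫ ω, X n ω * f ω ∂P ≤ -c := by
    intro n
    let E := X n ⁻¹' Set.Icc (-(p/4)) (p/4)
    have hE : MeasurableSet E := hX n measurableSet_Icc
    have hPE : P.real E ≤ p / 2 := by
      have h := aux_gauss_small (p/4) (by positivity)
      rw [← hlaw n, map_measureReal_apply (hX n) measurableSet_Icc] at h
      linarith
    have hdiff : p / 2 ≤ P.real (A \ E) := by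
      have := le_measureReal_sdiff (μ := P) (s₁ := A) (s₂ := E)
      linarith
    have hle : ∀ ω, X n ω * f ω ≤ (A \ E).indicator (fun _ => -(p/4)) ω := by
      intro ω
      by_cases h : ω ∈ A
      · have h0 := hAX n ω h
        by_cases h' : ω ∈ E
        · simp [hf, h, h', h0]
        · simp only [hf, h, h', Set.indicator, Set.mem_sdiff, if_true, not_false_eq_true, and_true, mul_one]
          by_contra hcon
          exact h' ⟨by linarith, by linarith⟩
      · simp [hf, h]
    have hi := integral_mono (hint n) ((integrable_const (-(p/4))).indicator (hA.diff hE)) hle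
    rw [integral_indicator (hA.diff hE)] at hi
    simp at hi
    nlinarith
  let Y : ℕ → Ω → ℝ := fun n ω => X n ω + c * f ω
  have hYL2 : ∀ n, MemLp (Y n) 2 P := fun n => (hL2 n).add (hfL2.const_mul c)
  have hYi : ∀ m n, Integrable (fun ω => Y m ω * Y n ω) P :=
    fun m n => (hYL2 m).integrable_mul (hYL2 n)
  have hXX : ∀ m n, Integrable (fun ω => X m ω * X n ω) P :=
    fun m n => (hL2 m).integrable_mul (hL2 n)
  have hffi : Integrable (fun ω => f ω * f ω) P := hfL2.integrable_mul hfL2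
  have hYY : ∀ m n, ∫ ω, Y m ω * Y n ω ∂P ≤ ∫ ω, X m ω * X n ω ∂P - c ^ 2 := by
    intro m n
    have e : (fun ω => Y m ω * Y n ω) = fun ω => (X m ω * X n ω + c * (X m ω * f ω))
        + (c * (X n ω * f ω) + c ^ 2 * (f ω * f ω)) := by
      ext ω; simp only [Y]; ring
    have i1 : Integrable (fun ω => X m ω * X n ω + c * (X m ω * f ω)) P :=
      (hXX m n).add ((hint m).const_mul c)
    have i2 : Integrable (fun ω => c * (X n ω * f ω) + c ^ 2 * (f ω * f ω)) P :=
      ((hint n).const_mul c).add (hffi.const_mul _)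
    rw [e, integral_add i1 i2,
      integral_add (hXX m n) ((hint m).const_mul c),
      integral_add ((hint n).const_mul c) (hffi.const_mul _),
      integral_const_mul, integral_const_mul, integral_const_mul, hff]
    have h1 := hXf m
    have h2 := hXf n
    nlinarith [sq_nonneg c]
  have hYY' : ∀ m n, ∫ ω, Y m ω * Y n ω ∂P ≤ (if m = n then 1 else 0) - c ^ 2 / 2 := by
    intro m n
    have h := hYY m n
    by_cases hmn : m = n
    · subst hmn
      rw [hvar] at h
      simp
      nlinarith [sq_nonneg c]
    · have := hcov m n hmn
      simp [hmn]
      linarith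
  obtain ⟨N, hN⟩ := exists_nat_gt (2 / c ^ 2)
  have hpos : 0 ≤ ∫ ω, (∑ m ∈ Finset.range N, Y m ω) * (∑ n ∈ Finset.range N, Y n ω) ∂P :=
    integral_nonneg fun ω => mul_self_nonneg _
  simp_rw [Finset.sum_mul_sum] at hpos
  rw [integral_finsetSum _ (fun m _ => integrable_finsetSum _ fun n _ => hYi m n)] at hpos
  simp_rw [integral_finsetSum _ (fun n _ => hYi _ n)] at hpos
  have hb : ∑ m ∈ Finset.range N, ∑ n ∈ Finset.range N, ∫ ω, Y m ω * Y n ω ∂P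
      ≤ ∑ m ∈ Finset.range N, ∑ n ∈ Finset.range N, ((if m = n then 1 else 0) - c ^ 2 / 2) :=
    Finset.sum_le_sum fun m _ => Finset.sum_le_sum fun n _ => hYY' m n
  have hs : ∑ m ∈ Finset.range N, ∑ n ∈ Finset.range N, ((if m = n then (1:ℝ) else 0) - c ^ 2 / 2)
      = N - N * (N * (c ^ 2 / 2)) := by
    simp only [Finset.sum_sub_distrib, Finset.sum_ite_eq, Finset.sum_const, Finset.card_range,
      nsmul_eq_mul]
    congr 1
    rw [Finset.sum_congr rfl (fun x hx => if_pos hx)]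
    simp
  rw [hs] at hb
  have hN0 : (0:ℝ) < N := lt_trans (by positivity) hN
  rw [div_lt_iff₀ (by positivity)] at hN
  nlinarith

lemma aux_rho (H : ℝ) (hH : H ∈ Set.Ioo (0:ℝ) 1) (s t : ℝ) (hs : 0 < s) (hst : s ≤ t) :
    (s ^ H)⁻¹ * (t ^ H)⁻¹ * ((1/2) * (t ^ (2*H) + s ^ (2*H) - |t - s| ^ (2*H)))
      ≤ (s / t) ^ (1 - H) + (s / t) ^ H := by
  obtain ⟨h0, h1⟩ := hH
  have ht : 0 < t := hs.trans_le hst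
  set r := s / t with hr
  have hr0 : 0 < r := by positivity
  have hr1 : r ≤ 1 := (div_le_one ht).2 hst
  have hsr : s = r * t := by rw [hr]; field_simp
  have e1 : |t - s| = (1 - r) * t := by rw [abs_of_nonneg (by linarith), hsr]; ring
  rw [e1, hsr, Real.mul_rpow hr0.le ht.le, Real.mul_rpow hr0.le ht.le,
    Real.mul_rpow (by linarith) ht.le]
  have e2 : t ^ (2 * H) = t ^ H * t ^ H := by rw [← Real.rpow_add ht]; ring_nf
  have e3 : r ^ (2 * H) = r ^ H * r ^ H := by rw [← Real.rpow_add hr0]; ring_nf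
  have e4 : r ^ (1 - H) = r / r ^ H := by rw [Real.rpow_sub hr0, Real.rpow_one]
  have e5 : 1 - 2 * r ≤ (1 - r) ^ (2 * H) := by
    have : (1 - r) ^ (2:ℝ) ≤ (1 - r) ^ (2 * H) :=
      Real.rpow_le_rpow_of_exponent_ge_of_imp (by linarith) (by linarith) (by linarith)
        (by intro _ h; linarith)
    rw [Real.rpow_two] at this
    nlinarith
  rw [e2, e3, e4]
  have htH : 0 < t ^ H := Real.rpow_pos_of_pos ht _
  have hrH : 0 < r ^ H := Real.rpow_pos_of_pos hr0 _
  set a := t ^ H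
  set b := r ^ H
  set d := (1 - r) ^ (2 * H)
  have : (b * a)⁻¹ * a⁻¹ * (1 / 2 * (a * a + b * b * (a * a) - d * (a * a)))
      = (1 + b * b - d) / 2 / b := by field_simp
  rw [this, div_add' _ _ _ hrH.ne']
  gcongr
  nlinarith

lemma aux_small (H : ℝ) (hH : H ∈ Set.Ioo (0:ℝ) 1) (η : ℝ) (hη : 0 < η) :
    ∃ δ, 0 < δ ∧ δ < 1 ∧ ∀ r, 0 < r → r ≤ δ → r ^ (1 - H) + r ^ H ≤ η := by
  have hc : ContinuousAt (fun r : ℝ => r ^ (1 - H) + r ^ H) 0 :=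
    (Real.continuousAt_rpow_const _ _ (Or.inr (by linarith [hH.2]))).add
      (Real.continuousAt_rpow_const _ _ (Or.inr hH.1.le))
  rw [Metric.continuousAt_iff] at hc
  obtain ⟨δ, hδ, h⟩ := hc η hη
  refine ⟨min (δ / 2) (1 / 2), by positivity, by
    exact lt_of_le_of_lt (min_le_right _ _) (by norm_num), fun r hr hrd => ?_⟩
  have h1 := le_trans hrd (min_le_left _ _)
  have := @h r (by rw [Real.dist_eq, sub_zero, abs_of_pos hr]; linarith)
  rw [Real.dist_eq, Real.zero_rpow (by linarith [hH.2]), Real.zero_rpow hH.1.ne'] at this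
  have := (abs_lt.1 this).2
  linarith

/-- Let `B` be a fractional Brownian motion with Hurst index `H ∈ (0,1)`
on `[0,T]` and let `M_t = max_{0 ≤ s ≤ t} B_s` be its running maximum.  Then for every
`t ∈ (0,T]`, `P{M_t = 0} = 0`. -/
theorem fbm_running_max_pos
    {Ω : Type*} [MeasurableSpace Ω] (P : Measure Ω) [IsProbabilityMeasure P]
    (H T : ℝ) (hH : H ∈ Set.Ioo (0:ℝ) 1) (hT : 0 < T)
    (B : ℝ → Ω → ℝ) (hB : IsFractionalBrownianMotion P H T B)
    (t : ℝ) (ht : t ∈ Set.Ioc 0 T) :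
    P {ω | runningMax B t ω = 0} = 0 := by
  obtain ⟨h0, hmeas, hcont, hgauss, hcov⟩ := hB
  by_contra hne
  set p := P.real {ω | runningMax B t ω = 0} with hp
  have hppos : 0 < p := by
    rw [hp, measureReal_def]
    exact ENNReal.toReal_pos hne (measure_ne_top _ _)
  obtain ⟨δ, hδ0, hδ1, hδ⟩ := aux_small H hH ((p ^ 2 / 8) ^ 2 / 2) (by positivity)
  let τ : ℕ → ℝ := fun n => t * δ ^ n
  have hτ0 : ∀ n, 0 < τ n := fun n => mul_pos ht.1 (pow_pos hδ0 n)
  have hτt : ∀ n, τ n ≤ t := fun n =>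
    mul_le_of_le_one_right ht.1.le (pow_le_one₀ hδ0.le hδ1.le)
  have hτT : ∀ n, τ n ∈ Set.Icc 0 T := fun n => ⟨(hτ0 n).le, (hτt n).trans ht.2⟩
  let X : ℕ → Ω → ℝ := fun n ω => (τ n ^ H)⁻¹ * B (τ n) ω
  have hXm : ∀ n, Measurable (X n) := fun n => (hmeas _ (hτT n)).const_mul _
  have hXX : ∀ m n, ∫ ω, X m ω * X n ω ∂P = (τ m ^ H)⁻¹ * (τ n ^ H)⁻¹ *
      ((1/2) * (τ n ^ (2*H) + τ m ^ (2*H) - |τ n - τ m| ^ (2*H))) := by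
    intro m n
    rw [← hcov _ (hτT m) _ (hτT n), ← integral_const_mul]
    congr 1; ext ω; simp only [X]; ring
  have hlaw : ∀ n, P.map (X n) = ProbabilityTheory.gaussianReal 0 1 := by
    intro n
    obtain ⟨v, hv⟩ := hgauss 1 (fun _ => (τ n ^ H)⁻¹) (fun _ => τ n) (fun _ => hτT n)
    simp only [Finset.univ_unique, Finset.sum_const, Finset.card_singleton, one_smul] at hv
    have hv' : P.map (X n) = ProbabilityTheory.gaussianReal 0 v := hv
    have h1 : ∫ x, x * x ∂(P.map (X n)) = ∫ ω, X n ω * X n ω ∂P :=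
      integral_map (hXm n).aemeasurable (by fun_prop)
    have h2 := ProbabilityTheory.variance_eq_integral
      (μ := ProbabilityTheory.gaussianReal 0 v) (X := id) (by fun_prop)
    rw [ProbabilityTheory.variance_id_gaussianReal] at h2
    simp only [id, ProbabilityTheory.integral_id_gaussianReal, sub_zero, sq] at h2
    rw [hv', ← h2, hXX, sub_self, abs_zero,
      Real.zero_rpow (by linarith [hH.1])] at h1
    have e2 : τ n ^ (2 * H) = τ n ^ H * τ n ^ H := by
      rw [← Real.rpow_add (hτ0 n)]; ring_nf
    have hpos : 0 < τ n ^ H := Real.rpow_pos_of_pos (hτ0 n) _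
    rw [e2] at h1
    have : (v : ℝ) = 1 := by rw [h1]; field_simp; norm_num
    rw [hv']
    congr 1
    exact_mod_cast this
  let A : Set Ω := {ω | ∀ n, X n ω ≤ 0}
  have hA : MeasurableSet A := by
    have : A = ⋂ n, {ω | X n ω ≤ 0} := by ext ω; simp [A]
    rw [this]
    exact MeasurableSet.iInter fun n => measurableSet_le (hXm n) measurable_const
  have hpA : p ≤ P.real A := by
    rw [hp, measureReal_def, measureReal_def]
    refine ENNReal.toReal_mono (measure_ne_top _ _) (measure_mono_ae ?_)
    filter_upwards [hcont] with ω hω hM n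
    have hM' : runningMax B t ω = 0 := hM
    have hbdd : BddAbove ((fun s => B s ω) '' Set.Icc 0 t) :=
      (isCompact_Icc.image_of_continuousOn
        (hω.mono (Set.Icc_subset_Icc_right ht.2))).bddAbove
    have : B (τ n) ω ≤ runningMax B t ω :=
      le_csSup hbdd ⟨τ n, ⟨(hτ0 n).le, hτt n⟩, rfl⟩
    rw [hM'] at this
    exact mul_nonpos_of_nonneg_of_nonpos
      (inv_nonneg.2 (Real.rpow_nonneg (hτ0 n).le _)) this
  have hlt : ∀ m n, n < m → ∫ ω, X m ω * X n ω ∂P ≤ (p ^ 2 / 8) ^ 2 / 2 := by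
    intro m n hmn
    have hr : τ m / τ n ≤ δ := by
      rw [div_le_iff₀ (hτ0 n)]
      have : δ ^ m ≤ δ ^ (n + 1) := pow_le_pow_of_le_one hδ0.le hδ1.le hmn
      have h2 := mul_le_mul_of_nonneg_left this ht.1.le
      simp only [τ]
      calc t * δ ^ m ≤ t * δ ^ (n + 1) := h2
        _ = δ * (t * δ ^ n) := by ring
    have hr' : τ m ≤ τ n := by
      have := hr.trans hδ1.le
      rwa [div_le_one (hτ0 n)] at this
    rw [hXX]
    exact (aux_rho H hH _ _ (hτ0 m) hr').trans (hδ _ (div_pos (hτ0 m) (hτ0 n)) hr)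
  refine aux_key P X hXm hlaw A hA (fun n ω h => h n) p hppos hpA fun m n hmn => ?_
  rcases lt_or_gt_of_ne hmn with h | h
  · have := hlt n m h
    simp_rw [mul_comm (X m _)]
    exact this
  · exact hlt m n h
end

section
/- Let B be a fractional Brownian motion with Hurst index H ∈ (0,1) on [0,T] and let M_t = max_{0≤s≤t} B_s be its running maximum. Then for every fixed t ∈ (0,T], P{ω ∈ Ω : M_t(ω) = B_t(ω)} = 0. -/
open MeasureTheory

open ProbabilityTheory

lemma gauss_small (ε : ℝ) (hε : 0 < ε) :
    (gaussianReal 0 1).real (Set.Ioo (-ε) ε) ≤ 2 * ε := by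
  have h : gaussianReal 0 1 (Set.Ioo (-ε) ε) ≤ ENNReal.ofReal (2 * ε) := by
    rw [gaussianReal_apply _ (by norm_num)]
    calc ∫⁻ x in Set.Ioo (-ε) ε, gaussianPDF 0 1 x
        ≤ ∫⁻ x in Set.Ioo (-ε) ε, 1 := by
          apply lintegral_mono
          intro x
          simp only [gaussianPDF]
          rw [ENNReal.ofReal_le_one, gaussianPDFReal]
          have h1 : (√(2 * Real.pi * ((1:NNReal):ℝ)))⁻¹ ≤ 1 := by
            apply inv_le_one_of_one_le₀
            rw [Real.one_le_sqrt]
            have := Real.pi_gt_three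
            simp; linarith
          have h2 : Real.exp (-(x - 0) ^ 2 / (2 * ((1:NNReal):ℝ))) ≤ 1 := by
            rw [Real.exp_le_one_iff]
            have := sq_nonneg (x - 0)
            simp only [NNReal.coe_one]
            linarith
          exact mul_le_one₀ h1 (Real.exp_nonneg _) h2
      _ = ENNReal.ofReal (2 * ε) := by
          rw [setLIntegral_one, Real.volume_Ioo]; congr 1; ring
  exact ENNReal.toReal_le_of_le_ofReal (by positivity) h

lemma memLp_of_gauss {Ω : Type*} [MeasurableSpace Ω] {P : Measure Ω} {v : NNReal}
    {Y : Ω → ℝ} (hm : Measurable Y) (h : P.map Y = gaussianReal 0 v) : MemLp Y 2 P := by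
  have h1 : MemLp id 2 (P.map Y) := by rw [h]; exact memLp_id_gaussianReal 2
  exact h1.comp_of_map hm.aemeasurable

lemma sq_of_gauss {Ω : Type*} [MeasurableSpace Ω] {P : Measure Ω} {v : NNReal}
    {Y : Ω → ℝ} (hm : Measurable Y) (h : P.map Y = gaussianReal 0 v) :
    ∫ ω, Y ω * Y ω ∂P = v := by
  have h1 : ∫ x, x * x ∂(P.map Y) = ∫ ω, Y ω * Y ω ∂P :=
    integral_map hm.aemeasurable (by fun_prop)
  rw [← h1, h]
  have h2 := variance_id_gaussianReal (μ := 0) (v := v)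
  rw [variance_eq_integral (by fun_prop)] at h2
  simp only [id, integral_id_gaussianReal, sub_zero] at h2
  rw [← h2]
  simp [sq]

lemma key {Ω : Type*} [MeasurableSpace Ω] {P : Measure Ω} [IsProbabilityMeasure P]
    (m : ℕ) (hm : 0 < m) (Y : Fin (m ^ 2) → Ω → ℝ) (hY : ∀ i, Measurable (Y i))
    (hl : ∀ i, P.map (Y i) = gaussianReal 0 1)
    (hc : ∀ i j, i ≠ j → ∫ ω, Y i ω * Y j ω ∂P ≤ 1 / (m:ℝ) ^ 2)
    (p : ℝ) (hp : 0 < p) (hA : p ≤ P.real {ω | ∀ i, 0 ≤ Y i ω}) :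
    p ^ 2 / 8 * m ≤ 3 / 2 := by
  have hm' : (0:ℝ) < m := by exact_mod_cast hm
  set A := {ω | ∀ i, 0 ≤ Y i ω} with hAdef
  have hAm : MeasurableSet A := by
    rw [hAdef, Set.ofPred_forall]
    exact MeasurableSet.iInter fun i => measurableSet_le measurable_const (hY i)
  set ε := p / 4 with hε
  have hε0 : 0 < ε := by positivity
  let D : Fin (m ^ 2) → Set Ω := fun i => Y i ⁻¹' Set.Ioo (-ε) ε
  have hDm : ∀ i, MeasurableSet (D i) := fun i => hY i measurableSet_Ioo
  have hD : ∀ i, P.real (D i) ≤ 2 * ε := by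
    intro i
    have := gauss_small ε hε0
    rw [← hl i, map_measureReal_apply (hY i) measurableSet_Ioo] at this
    exact this
  have hL : ∀ i, MemLp (Y i) 2 P := fun i => memLp_of_gauss (hY i) (hl i)
  have hI : ∀ i j, Integrable (fun ω => Y i ω * Y j ω) P := fun i j =>
    (hL i).integrable_mul (hL j)
  have hS2 : ∀ ω, (∑ i, Y i ω) ^ 2 = ∑ i, ∑ j, Y i ω * Y j ω := by
    intro ω; rw [sq, Finset.sum_mul_sum]
  have hSI : Integrable (fun ω => (∑ i, Y i ω) ^ 2) P := by
    simp_rw [hS2]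
    exact integrable_finsetSum _ fun i _ => integrable_finsetSum _ fun j _ => hI i j
  have hSE : ∫ ω, (∑ i, Y i ω) ^ 2 ∂P ≤ 2 * (m:ℝ) ^ 2 := by
    simp_rw [hS2]
    rw [integral_finsetSum _ fun i _ => integrable_finsetSum _ fun j _ => hI i j]
    have : ∀ i, ∫ ω, ∑ j, Y i ω * Y j ω ∂P ≤ 2 := by
      intro i
      rw [integral_finsetSum _ fun j _ => hI i j]
      calc ∑ j, ∫ ω, Y i ω * Y j ω ∂P ≤ ∑ j, ((if i = j then 1 else 0) + 1 / (m:ℝ) ^ 2) := by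
            apply Finset.sum_le_sum
            intro j _
            by_cases hij : i = j
            · subst hij
              rw [sq_of_gauss (hY i) (hl i)]
              simp
            · simpa [hij] using hc i j hij
        _ = 2 := by
            rw [Finset.sum_add_distrib]
            simp
            field_simp
            norm_num
    calc _ ≤ ∑ i : Fin (m ^ 2), (2:ℝ) := Finset.sum_le_sum fun i _ => this i
      _ = _ := by simp; ring
  have hpt : ∀ ω, ∑ i, ε * (A.indicator 1 ω - (D i).indicator 1 ω)
      ≤ (m + (∑ i, Y i ω) ^ 2 / m) / 2 := by
    intro ω
    have hR : ∑ i, Y i ω ≤ (m + (∑ i, Y i ω) ^ 2 / m) / 2 := by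
      have h : (m + (∑ i, Y i ω) ^ 2 / m) / 2 - ∑ i, Y i ω
          = (∑ i, Y i ω - m) ^ 2 / m / 2 := by field_simp; ring
      have : 0 ≤ (∑ i, Y i ω - m) ^ 2 / m / 2 := by positivity
      linarith
    by_cases hω : ω ∈ A
    · refine le_trans (Finset.sum_le_sum fun i _ => ?_) hR
      have hi : 0 ≤ Y i ω := hω i
      by_cases hd : ω ∈ D i
      · simpa [hω, hd] using hi
      · have : ε ≤ Y i ω := by
          by_contra hlt
          push Not at hlt
          exact hd ⟨by linarith, hlt⟩
        simpa [hω, hd] using this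
    · have h0 : 0 ≤ (m + (∑ i, Y i ω) ^ 2 / m) / 2 := by positivity
      refine le_trans (Finset.sum_nonpos fun i _ => ?_) h0
      have : (0:ℝ) ≤ (D i).indicator 1 ω := Set.indicator_nonneg (by simp) _
      rw [Set.indicator_of_notMem hω]
      nlinarith
  have hAi : Integrable (A.indicator (1 : Ω → ℝ)) P :=
    (integrable_const (1:ℝ)).indicator hAm
  have hDi : ∀ i, Integrable ((D i).indicator (1 : Ω → ℝ)) P := fun i =>
    (integrable_const (1:ℝ)).indicator (hDm i)
  have hint : ∀ i, Integrable (fun ω => ε * (A.indicator 1 ω - (D i).indicator 1 ω)) P :=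
    fun i => (hAi.sub (hDi i)).const_mul ε
  have h1 := integral_mono (μ := P) (integrable_finsetSum _ fun i _ => hint i)
    (((integrable_const (m:ℝ)).add (hSI.div_const m)).div_const 2) hpt
  rw [integral_finsetSum _ fun i _ => hint i] at h1
  have h2 : ∀ i, p ^ 2 / 8 ≤ ∫ ω, ε * (A.indicator 1 ω - (D i).indicator 1 ω) ∂P := by
    intro i
    rw [integral_const_mul, integral_sub hAi (hDi i), integral_indicator_one hAm,
      integral_indicator_one (hDm i)]
    have := hD i
    have h3 : p / 2 ≤ P.real A - P.real (D i) := by linarith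
    calc p ^ 2 / 8 = ε * (p / 2) := by rw [hε]; ring
      _ ≤ _ := by gcongr
  have h3 : (m:ℝ) ^ 2 * (p ^ 2 / 8) ≤ 3 / 2 * m := by
    calc (m:ℝ) ^ 2 * (p ^ 2 / 8) = ∑ i : Fin (m ^ 2), p ^ 2 / 8 := by simp
      _ ≤ _ := Finset.sum_le_sum fun i _ => h2 i
      _ ≤ _ := h1
      _ = (m + (∫ ω, (∑ i, Y i ω) ^ 2 ∂P) / m) / 2 := by
          simp only [Pi.add_apply]
          rw [integral_div, integral_add (integrable_const _) (hSI.div_const m), integral_div]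
          simp
      _ ≤ (m + (2 * (m:ℝ) ^ 2) / m) / 2 := by gcongr
      _ = _ := by field_simp; norm_num
  have h4 : m * (p ^ 2 / 8 * m) ≤ m * (3 / 2 : ℝ) := by linarith
  exact le_of_mul_le_mul_left h4 hm'

section
variable {Ω : Type*} [MeasurableSpace Ω] {P : Measure Ω} [IsProbabilityMeasure P]
    {H T : ℝ} {B : ℝ → Ω → ℝ}

lemma fbm_memLp (hB : IsFractionalBrownianMotion P H T B) {s : ℝ} (hs : s ∈ Set.Icc 0 T) :
    MemLp (B s) 2 P := by
  obtain ⟨-, hm, -, hg, -⟩ := hB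
  obtain ⟨v, hv⟩ := hg 1 ![1] ![s] (by simpa using hs)
  simp at hv
  exact memLp_of_gauss (hm s hs) hv

lemma fbm_cov (hB : IsFractionalBrownianMotion P H T B) (hH : H ∈ Set.Ioo (0:ℝ) 1)
    {t : ℝ} (ht : t ∈ Set.Ioc 0 T) {u v : ℝ} (hu : u ∈ Set.Ioc 0 t) (hv : v ∈ Set.Ioc 0 t) :
    ∫ ω, (B t ω - B (t - u) ω) * (B t ω - B (t - v) ω) ∂P
      = 1 / 2 * (u ^ (2 * H) + v ^ (2 * H) - |u - v| ^ (2 * H)) := by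
  have a1 : t ∈ Set.Icc 0 T := ⟨ht.1.le, ht.2⟩
  have a2 : t - u ∈ Set.Icc 0 T := ⟨by linarith [hu.2], by linarith [hu.1, ht.2]⟩
  have a3 : t - v ∈ Set.Icc 0 T := ⟨by linarith [hv.2], by linarith [hv.1, ht.2]⟩
  have I : ∀ {a b : ℝ}, a ∈ Set.Icc 0 T → b ∈ Set.Icc 0 T →
      Integrable (fun ω => B a ω * B b ω) P := fun ha hb =>
    (fbm_memLp hB ha).integrable_mul (fbm_memLp hB hb)
  have e : ∀ ω, (B t ω - B (t - u) ω) * (B t ω - B (t - v) ω)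
      = (B t ω * B t ω - B t ω * B (t - v) ω)
        - (B (t - u) ω * B t ω - B (t - u) ω * B (t - v) ω) := fun ω => by ring
  simp_rw [e]
  have J1 : Integrable (fun ω => B t ω * B t ω - B t ω * B (t - v) ω) P :=
    (I a1 a1).sub (I a1 a3)
  have J2 : Integrable (fun ω => B (t - u) ω * B t ω - B (t - u) ω * B (t - v) ω) P :=
    (I a2 a1).sub (I a2 a3)
  rw [integral_sub J1 J2,
    integral_sub (I a1 a1) (I a1 a3), integral_sub (I a2 a1) (I a2 a3)]
  obtain ⟨-, -, -, -, hc⟩ := hB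
  rw [hc _ a1 _ a1, hc _ a1 _ a3, hc _ a2 _ a1, hc _ a2 _ a3]
  have z : (0:ℝ) ^ (2 * H) = 0 := Real.zero_rpow (by linarith [hH.1])
  have e1 : |t - v - t| = v := by rw [abs_of_nonpos] <;> linarith [hv.1]
  have e2 : |t - (t - u)| = u := by rw [abs_of_nonneg] <;> linarith [hu.1]
  have e3 : t - v - (t - u) = u - v := by ring
  rw [e1, e2, e3, sub_self, abs_zero, z]
  ring

/-- normalized backwards increment -/
noncomputable def nY (B : ℝ → Ω → ℝ) (H t u : ℝ) (ω : Ω) : ℝ :=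
  (u ^ H)⁻¹ * (B t ω - B (t - u) ω)

lemma nY_meas (hB : IsFractionalBrownianMotion P H T B)
    {t : ℝ} (ht : t ∈ Set.Ioc 0 T) {u : ℝ} (hu : u ∈ Set.Ioc 0 t) :
    Measurable (nY B H t u) := by
  have a1 : t ∈ Set.Icc 0 T := ⟨ht.1.le, ht.2⟩
  have a2 : t - u ∈ Set.Icc 0 T := ⟨by linarith [hu.2], by linarith [hu.1, ht.2]⟩
  exact ((hB.2.1 t a1).sub (hB.2.1 _ a2)).const_mul _

lemma nY_cov (hB : IsFractionalBrownianMotion P H T B) (hH : H ∈ Set.Ioo (0:ℝ) 1)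
    {t : ℝ} (ht : t ∈ Set.Ioc 0 T) {u v : ℝ} (hu : u ∈ Set.Ioc 0 t) (hv : v ∈ Set.Ioc 0 t) :
    ∫ ω, nY B H t u ω * nY B H t v ω ∂P
      = (u ^ H)⁻¹ * (v ^ H)⁻¹ * (1 / 2 * (u ^ (2 * H) + v ^ (2 * H) - |u - v| ^ (2 * H))) := by
  rw [← fbm_cov hB hH ht hu hv, ← integral_const_mul]
  congr 1; ext ω; simp only [nY]; ring

lemma nY_law (hB : IsFractionalBrownianMotion P H T B) (hH : H ∈ Set.Ioo (0:ℝ) 1)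
    {t : ℝ} (ht : t ∈ Set.Ioc 0 T) {u : ℝ} (hu : u ∈ Set.Ioc 0 t) :
    P.map (nY B H t u) = gaussianReal 0 1 := by
  have a1 : t ∈ Set.Icc 0 T := ⟨ht.1.le, ht.2⟩
  have a2 : t - u ∈ Set.Icc 0 T := ⟨by linarith [hu.2], by linarith [hu.1, ht.2]⟩
  obtain ⟨v, hv⟩ := hB.2.2.2.1 2 ![(u ^ H)⁻¹, -(u ^ H)⁻¹] ![t, t - u] (by
    intro i; fin_cases i
    · exact a1
    · exact a2)
  have e : (fun ω => ∑ i, (![(u ^ H)⁻¹, -(u ^ H)⁻¹] : Fin 2 → ℝ) i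
      * B ((![t, t - u] : Fin 2 → ℝ) i) ω) = nY B H t u := by
    ext ω; simp [Fin.sum_univ_two, nY]; ring
  rw [e] at hv
  have h1 := sq_of_gauss (nY_meas hB ht hu) hv
  rw [nY_cov hB hH ht hu hu, sub_self, abs_zero, Real.zero_rpow (by linarith [hH.1]),
    mul_comm 2 H, Real.rpow_mul hu.1.le] at h1
  have hpos : 0 < u ^ H := Real.rpow_pos_of_pos hu.1 _
  have : (v:ℝ) = 1 := by
    rw [← h1, Real.rpow_two]; field_simp; norm_num
  have : v = 1 := by exact_mod_cast this
  rw [hv, this]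

lemma nY_cov_le (hB : IsFractionalBrownianMotion P H T B) (hH : H ∈ Set.Ioo (0:ℝ) 1)
    {t : ℝ} (ht : t ∈ Set.Ioc 0 T) {u x : ℝ} (hu : u ∈ Set.Ioc 0 t) (hx : x ∈ Set.Ioo (0:ℝ) 1) :
    ∫ ω, nY B H t u ω * nY B H t (u * x) ω ∂P ≤ 1 / 2 * (x ^ H + 2 * x ^ (1 - H)) := by
  have hv : u * x ∈ Set.Ioc 0 t :=
    ⟨mul_pos hu.1 hx.1, by nlinarith [hu.1, hu.2, hx.2]⟩
  rw [nY_cov hB hH ht hu hv]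
  have e : |u - u * x| = u * (1 - x) := by
    rw [abs_of_nonneg] <;> nlinarith [hu.1, hx.2]
  have hx1 : 0 ≤ 1 - x := by linarith [hx.2]
  have hb : 1 - 2 * x ≤ (1 - x) ^ (2 * H) := by
    have : (1 - x) ^ (2:ℝ) ≤ (1 - x) ^ (2 * H) :=
      Real.rpow_le_rpow_of_exponent_ge (by linarith [hx.2]) (by linarith [hx.1])
        (by linarith [hH.2])
    rw [Real.rpow_two] at this
    nlinarith [sq_nonneg x]
  rw [e, Real.mul_rpow hu.1.le hx.1.le, Real.mul_rpow hu.1.le hx.1.le,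
    Real.mul_rpow hu.1.le hx1]
  have eu : u ^ (2 * H) = (u ^ H) ^ 2 := by
    rw [mul_comm, Real.rpow_mul hu.1.le, Real.rpow_two]
  have ex : x ^ (2 * H) = (x ^ H) ^ 2 := by
    rw [mul_comm, Real.rpow_mul hx.1.le, Real.rpow_two]
  have ex1 : x ^ (1 - H) = x / x ^ H := by
    rw [Real.rpow_sub hx.1, Real.rpow_one]
  rw [eu, ex, ex1]
  have pu : 0 < u ^ H := Real.rpow_pos_of_pos hu.1 _
  have px : 0 < x ^ H := Real.rpow_pos_of_pos hx.1 _
  set a := u ^ H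
  set b := x ^ H
  set c := (1 - x) ^ (2 * H)
  have l : a⁻¹ * (a * b)⁻¹ * (1 / 2 * (a ^ 2 + a ^ 2 * b ^ 2 - a ^ 2 * c))
      = 1 / 2 * (b + (1 - c) / b) := by field_simp; ring
  rw [l]
  have : (1 - c) / b ≤ 2 * x / b := by gcongr; linarith
  have h2 : 2 * (x / b) = 2 * x / b := by ring
  rw [h2]; linarith

end

lemma exists_small (H : ℝ) (hH : H ∈ Set.Ioo (0:ℝ) 1) (δ : ℝ) (hδ : 0 < δ) :
    ∃ r ∈ Set.Ioo (0:ℝ) 1, ∀ x ∈ Set.Ioc 0 r, 1 / 2 * (x ^ H + 2 * x ^ (1 - H)) ≤ δ := by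
  have hc : Filter.Tendsto (fun x : ℝ => 1 / 2 * (x ^ H + 2 * x ^ (1 - H))) (nhds 0) (nhds 0) := by
    have h1 := (Real.continuousAt_rpow_const 0 H (Or.inr hH.1.le)).tendsto
    have h2 := (Real.continuousAt_rpow_const 0 (1 - H) (Or.inr (by linarith [hH.2]))).tendsto
    rw [Real.zero_rpow hH.1.ne'] at h1
    rw [Real.zero_rpow (by linarith [hH.2])] at h2
    have h3 := (h1.add (h2.const_mul 2)).const_mul (1 / 2)
    have h0 : (1 / 2 * (0 + 2 * 0) : ℝ) = 0 := by norm_num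
    rw [h0] at h3
    exact h3
  have := hc.eventually (gt_mem_nhds hδ)
  obtain ⟨η, hη, h⟩ := Metric.eventually_nhds_iff.1 this
  refine ⟨min (η / 2) (1 / 2), ⟨by positivity, ?_⟩, fun x hx => ?_⟩
  · exact lt_of_le_of_lt (min_le_right _ _) (by norm_num)
  · refine (h ?_).le
    rw [Real.dist_eq, sub_zero, abs_of_pos hx.1]
    have := hx.2.trans (min_le_left _ _)
    linarith

theorem fbm_prob_at_max_eq_zero
    {Ω : Type*} [MeasurableSpace Ω] (P : Measure Ω) [IsProbabilityMeasure P]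
    (H T : ℝ) (hH : H ∈ Set.Ioo (0:ℝ) 1) (hT : 0 < T)
    (B : ℝ → Ω → ℝ) (hB : IsFractionalBrownianMotion P H T B)
    (t : ℝ) (ht : t ∈ Set.Ioc 0 T) :
    P {ω | runningMax B t ω = B t ω} = 0 := by
  by_contra hne
  set p := P.real {ω | runningMax B t ω = B t ω} with hpdef
  have hp : 0 < p := ENNReal.toReal_pos hne (measure_ne_top _ _)
  obtain ⟨m, hm⟩ := exists_nat_gt (3 / 2 / (p ^ 2 / 8))
  have hm0 : (0:ℝ) < m := lt_trans (by positivity) hm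
  have hmpos : 0 < m := by exact_mod_cast hm0
  rw [div_lt_iff₀ (by positivity)] at hm
  obtain ⟨r, hr, hrx⟩ := exists_small H hH (1 / (m:ℝ) ^ 2) (by positivity)
  have hu : ∀ i : ℕ, t * r ^ i ∈ Set.Ioc 0 t := fun i =>
    ⟨mul_pos ht.1 (pow_pos hr.1 i),
      mul_le_of_le_one_right ht.1.le (pow_le_one₀ hr.1.le hr.2.le)⟩
  have hlt : ∀ i j : ℕ, i < j →
      ∫ ω, nY B H t (t * r ^ i) ω * nY B H t (t * r ^ j) ω ∂P ≤ 1 / (m:ℝ) ^ 2 := by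
    intro i j hij
    obtain ⟨d, rfl⟩ := Nat.exists_eq_add_of_lt hij
    have hxr : r ^ (d + 1) ≤ r := by
      rw [pow_succ]
      exact mul_le_of_le_one_left hr.1.le (pow_le_one₀ hr.1.le hr.2.le)
    have hx0 : 0 < r ^ (d + 1) := pow_pos hr.1 _
    have := nY_cov_le hB hH ht (hu i) (x := r ^ (d + 1)) ⟨hx0, lt_of_le_of_lt hxr hr.2⟩
    have e : t * r ^ (i + d + 1) = t * r ^ i * r ^ (d + 1) := by ring
    rw [e]
    exact this.trans (hrx _ ⟨hx0, hxr⟩)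
  have := key (P := P) m hmpos (fun i => nY B H t (t * r ^ (i:ℕ)))
    (fun i => nY_meas hB ht (hu i)) (fun i => nY_law hB hH ht (hu i))
    (fun i j hij => by
      rcases lt_or_gt_of_ne (fun h => hij (Fin.ext h) : (i:ℕ) ≠ j) with h | h
      · exact hlt _ _ h
      · have := hlt _ _ h
        simp_rw [mul_comm (nY B H t (t * r ^ (i:ℕ)) _)]
        exact this) p hp (by
      rw [hpdef]
      refine ENNReal.toReal_mono (measure_ne_top _ _) (measure_mono_ae ?_)
      filter_upwards [hB.2.2.1] with ω hω hmax
      intro i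
      have hcont : ContinuousOn (fun s => B s ω) (Set.Icc 0 t) :=
        hω.mono (Set.Icc_subset_Icc_right ht.2)
      have hbdd := (isCompact_Icc.image_of_continuousOn hcont).bddAbove
      have hle : B (t - t * r ^ (i:ℕ)) ω ≤ runningMax B t ω :=
        le_csSup hbdd ⟨t - t * r ^ (i:ℕ), ⟨by linarith [(hu i).2], by linarith [(hu i).1]⟩, rfl⟩
      have hmax' : runningMax B t ω = B t ω := hmax
      rw [hmax'] at hle
      have : 0 ≤ ((t * r ^ (i:ℕ)) ^ H)⁻¹ := by
        have := Real.rpow_nonneg (hu i).1.le H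
        positivity
      exact mul_nonneg this (by linarith))
  linarith
end

section
/- Let B be a fractional Brownian motion with Hurst index H ∈ (0,1) on [0,T] and let M_t = max_{0≤s≤t} B_s be its running maximum. Then almost surely the set E_ω = {t ∈ [0,T] : B_t(ω) = M_t(ω)} has Lebesgue measure zero: m(E_ω) = 0 for P-almost every ω. -/
open MeasureTheory

open ProbabilityTheory


lemma lawSmall : ∀ p : ℝ, 0 < p → ∃ δ : ℝ, 0 < δ ∧ (gaussianReal 0 1).real (Set.Icc 0 δ) < p := by
  intro p hp
  have : NullSingletonClass (gaussianReal 0 1) := nullSingletonClass_gaussianReal (by norm_num)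
  have h := tendsto_measure_iInter_atTop (μ := gaussianReal 0 1) (s := fun n : ℕ => Set.Icc (0:ℝ) (1/((n:ℝ)+1)))
    (fun n => measurableSet_Icc.nullMeasurableSet)
    (fun m n hmn => Set.Icc_subset_Icc_right (one_div_le_one_div_of_le (by positivity) (add_le_add_left (Nat.cast_le.2 hmn) 1)))
    ⟨0, measure_ne_top _ _⟩
  have h0 : (⋂ n : ℕ, Set.Icc (0:ℝ) (1/((n:ℝ)+1))) = {0} := by
    ext x
    simp only [Set.mem_iInter, Set.mem_Icc, Set.mem_singleton_iff]
    constructor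
    · intro hx
      refine le_antisymm ?_ (hx 0).1
      exact ge_of_tendsto' (tendsto_one_div_add_atTop_nhds_zero_nat (𝕜 := ℝ)) (fun n => (hx n).2)
    · rintro rfl n
      exact ⟨le_rfl, by positivity⟩
  rw [h0, measure_singleton] at h
  have h2 := (ENNReal.tendsto_toReal ENNReal.zero_ne_top).comp h
  obtain ⟨n, hn⟩ := (h2.eventually_lt_const (u := p) (by simpa using hp)).exists
  exact ⟨1/((n:ℝ)+1), by positivity, hn⟩

lemma key_s7 {Ω : Type*} [MeasurableSpace Ω] (P : Measure Ω) [IsProbabilityMeasure P]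
    (A : Set Ω) (hA : MeasurableSet A)
    (h : ∀ N : ℕ, 0 < N → ∃ Y : ℕ → Ω → ℝ, (∀ n, Measurable (Y n)) ∧
      (∀ n, P.map (Y n) = gaussianReal 0 1) ∧ 
      (∀ i j, i ≠ j → ∫ ω, Y i ω * Y j ω ∂P ≤ 1 / (N:ℝ)) ∧
      (∀ n, ∀ ω ∈ A, 0 ≤ Y n ω)) : P A = 0 := by
  by_contra hne
  have hp : 0 < P.real A := by
    rw [measureReal_def]
    exact ENNReal.toReal_pos hne (measure_ne_top _ _)
  obtain ⟨δ, hδ, hδp⟩ := lawSmall _ hp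
  set g := (gaussianReal 0 1).real (Set.Icc 0 δ) with hg
  have hc : 0 < δ * (P.real A - g) := mul_pos hδ (by linarith)
  set c := δ * (P.real A - g) with hcdef
  have main : ∀ N : ℕ, 0 < N → ∀ l : ℝ, 0 < l → c ≤ l + (2 / N) / l := by
    intro N hN l hl
    obtain ⟨Y, hYm, hYlaw, hcov, hpos⟩ := h N hN
    have hN' : (0:ℝ) < N := by exact_mod_cast hN
    have hL2 : ∀ n, MemLp (Y n) 2 P := by
      intro n
      have := memLp_id_gaussianReal (μ := 0) (v := 1) 2
      rw [← hYlaw n] at this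
      exact (memLp_map_measure_iff (by fun_prop) (hYm n).aemeasurable).1 this
    have hint : ∀ n, Integrable (Y n) P := fun n => (hL2 n).integrable (by norm_num)
    have hprod : ∀ i j, Integrable (fun ω => Y i ω * Y j ω) P := fun i j => (hL2 i).integrable_mul (hL2 j)
    have hvar : ∀ n, ∫ ω, Y n ω * Y n ω ∂P = 1 := by
      intro n
      have h1 : ∫ x, x * x ∂(gaussianReal 0 1) = 1 := by
        have := variance_id_gaussianReal (μ := 0) (v := 1)
        rw [variance_of_integral_eq_zero (by fun_prop) (by simp)] at this
        simpa [sq] using this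
      rw [← hYlaw n, integral_map (hYm n).aemeasurable (by fun_prop)] at h1
      exact h1
    have low : ∀ n, c ≤ ∫ ω in A, Y n ω ∂P := by
      intro n
      have hgm : g = P.real (Y n ⁻¹' Set.Icc 0 δ) := by
        rw [hg, ← hYlaw n, measureReal_def, Measure.map_apply (hYm n) measurableSet_Icc]; rfl
      set C := A \ (Y n ⁻¹' Set.Icc 0 δ) with hC
      have hCm : MeasurableSet C := hA.diff (hYm n measurableSet_Icc)
      have h1 : P.real A - g ≤ P.real C := by
        rw [hgm]
        have : P.real A ≤ P.real (C ∪ (Y n ⁻¹' Set.Icc 0 δ)) := measureReal_mono (by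
          intro ω hω
          by_cases h : ω ∈ Y n ⁻¹' Set.Icc 0 δ
          · exact Or.inr h
          · exact Or.inl ⟨hω, h⟩)
        have := measureReal_union_le (μ := P) C (Y n ⁻¹' Set.Icc 0 δ)
        linarith
      calc c ≤ δ * P.real C := mul_le_mul_of_nonneg_left h1 hδ.le
        _ = ∫ ω in C, δ ∂P := by simp [mul_comm]
        _ ≤ ∫ ω in C, Y n ω ∂P := by
          refine setIntegral_mono_on (by simp) (hint n).integrableOn hCm ?_
          intro ω hω
          by_contra hlt
          exact hω.2 ⟨hpos n ω hω.1, (not_le.1 hlt).le⟩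
        _ ≤ ∫ ω in A, Y n ω ∂P := by
          refine setIntegral_mono_set (hint n).integrableOn ?_ (Set.sdiff_subset.eventuallyLE)
          exact (ae_restrict_iff' hA).2 (Filter.Eventually.of_forall (hpos n))
    set S : Ω → ℝ := fun ω => (1/(N:ℝ)) * ∑ n ∈ Finset.range N, Y n ω with hS
    have hSint : Integrable S P := (integrable_finsetSum _ (fun n _ => hint n)).const_mul _
    have hSlow : c ≤ ∫ ω in A, S ω ∂P := by
      rw [hS, integral_const_mul, integral_finsetSum _ (fun n _ => (hint n).integrableOn)]
      have : (N:ℝ) * c ≤ ∑ n ∈ Finset.range N, ∫ ω in A, Y n ω ∂P := by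
        have := Finset.card_nsmul_le_sum (Finset.range N) (fun n => ∫ ω in A, Y n ω ∂P) c (fun n _ => low n)
        simpa using this
      rw [one_div, ← div_eq_inv_mul, le_div_iff₀ hN']; linarith
    have hS2e : (fun ω => S ω ^ 2) = fun ω => (1/(N:ℝ))^2 * ∑ i ∈ Finset.range N, ∑ j ∈ Finset.range N, Y i ω * Y j ω := by
      ext ω
      simp only [hS, mul_pow]
      rw [sq (∑ n ∈ Finset.range N, Y n ω), Finset.sum_mul_sum]
    have hSS : Integrable (fun ω => S ω ^ 2) P := by
      rw [hS2e]
      exact (integrable_finsetSum _ fun i _ => integrable_finsetSum _ fun j _ => hprod i j).const_mul _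
    have hS2 : ∫ ω, S ω ^ 2 ∂P ≤ 2 / N := by
      rw [hS2e, integral_const_mul, integral_finsetSum _ (fun i _ => integrable_finsetSum _ fun j _ => hprod i j)]
      have : ∀ i ∈ Finset.range N, ∫ ω, ∑ j ∈ Finset.range N, Y i ω * Y j ω ∂P ≤ 2 := by
        intro i hi
        rw [integral_finsetSum _ (fun j _ => hprod i j)]
        calc ∑ j ∈ Finset.range N, ∫ ω, Y i ω * Y j ω ∂P 
            ≤ ∑ j ∈ Finset.range N, ((if i = j then 1 else 0) + 1/(N:ℝ)) := by
              apply Finset.sum_le_sum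
              intro j _
              by_cases hij : i = j
              · subst hij
                rw [hvar]; simp
              · simpa [hij] using hcov i j hij
          _ = 2 := by
              rw [Finset.sum_add_distrib, Finset.sum_ite_eq, if_pos hi]
              simp [hN'.ne']; norm_num
      have h2 := Finset.sum_le_card_nsmul _ _ _ this
      simp only [Finset.card_range, nsmul_eq_mul] at h2
      calc _ ≤ (1/(N:ℝ))^2 * (N * 2) := mul_le_mul_of_nonneg_left h2 (by positivity)
        _ = 2 / N := by field_simp
    calc c ≤ ∫ ω in A, S ω ∂P := hSlow
      _ ≤ ∫ ω in A, (l + S ω ^ 2 / l) ∂P := by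
        refine setIntegral_mono hSint.integrableOn ((integrable_const _).add (hSS.div_const _)).integrableOn ?_
        intro ω
        show S ω ≤ l + S ω ^ 2 / l
        rw [← sub_nonneg]
        have : l + S ω ^ 2 / l - S ω = ((S ω - l/2)^2 + 3/4*l^2) / l := by field_simp; ring
        rw [this]; positivity
      _ ≤ ∫ ω, (l + S ω ^ 2 / l) ∂P := by
        refine setIntegral_le_integral ((integrable_const _).add (hSS.div_const _)) (Filter.Eventually.of_forall fun ω => ?_)
        show 0 ≤ l + S ω ^ 2 / l
        positivity
      _ = l + (∫ ω, S ω ^ 2 ∂P) / l := by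
        rw [integral_add (integrable_const _) (hSS.div_const _), integral_div]; simp
      _ ≤ _ := by gcongr
  obtain ⟨N, hN⟩ := exists_nat_gt (8 / c^2)
  have hN0 : (0:ℝ) < N := lt_trans (by positivity) hN
  have := main N (by exact_mod_cast hN0) (c/2) (by positivity)
  rw [div_lt_iff₀ (by positivity)] at hN
  have h3 : 2 / (N:ℝ) / (c/2) < c / 2 := by
    rw [div_lt_iff₀ (by positivity), div_lt_iff₀ hN0]; nlinarith
  linarith

lemma corr_bound (H : ℝ) (hH : H ∈ Set.Ioo (0:ℝ) 1) (u q r : ℝ) (hu : 0 < u) (hq : 0 < q) (hqr : q ≤ r)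
    (hr : r < 1) :
    (q*u)^(-H) * u^(-H) * ((1/2) * ((q*u)^(2*H) + u^(2*H) - (u-q*u)^(2*H))) ≤ r^H + r^(1-H) := by
  obtain ⟨h0, h1⟩ := hH
  have e1 : u - q*u = (1-q)*u := by ring
  have hq1 : 0 < 1 - q := by linarith
  rw [e1, Real.mul_rpow hq.le hu.le, Real.mul_rpow hq.le hu.le, Real.mul_rpow hq1.le hu.le]
  have eu : u^(-H) * u^(-H) * u^(2*H) = 1 := by
    rw [← Real.rpow_add hu, ← Real.rpow_add hu]; ring_nf; simp
  have e2 : q^(-H) * q^(2*H) = q^H := by rw [← Real.rpow_add hq]; ring_nf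
  have e3 : q^(-H) * q = q^(1-H) := by
    nth_rewrite 2 [← Real.rpow_one q]; rw [← Real.rpow_add hq]; ring_nf
  have b : (1-q)^2 ≤ (1-q)^(2*H) := by
    rw [← Real.rpow_two]
    exact Real.rpow_le_rpow_of_exponent_ge hq1 (by linarith) (by linarith)
  have b' : 1 - (1-q)^(2*H) ≤ 2*q := by nlinarith
  have hp : 0 < q^(-H) := Real.rpow_pos_of_pos hq _
  have b1 : q^H ≤ r^H := Real.rpow_le_rpow hq.le hqr h0.le
  have b2 : q^(1-H) ≤ r^(1-H) := Real.rpow_le_rpow hq.le hqr (by linarith)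
  have b3 : 0 < q^H := Real.rpow_pos_of_pos hq _
  calc _ = (u^(-H) * u^(-H) * u^(2*H)) * ((1/2) * (q^(-H) * q^(2*H) + q^(-H) * (1 - (1-q)^(2*H)))) := by ring
    _ = (1/2) * (q^H + q^(-H) * (1 - (1-q)^(2*H))) := by rw [eu, e2]; ring
    _ ≤ (1/2) * (q^H + q^(-H) * (2*q)) := by gcongr
    _ = (1/2) * q^H + q^(1-H) := by rw [← e3]; ring
    _ ≤ _ := by linarith

lemma exists_k (H : ℝ) (hH : H ∈ Set.Ioo (0:ℝ) 1) (ε : ℝ) (hε : 0 < ε) :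
    ∃ k : ℕ, (1/((k:ℝ)+2))^H + (1/((k:ℝ)+2))^(1-H) ≤ ε := by
  have h0 : Filter.Tendsto (fun k : ℕ => 1/((k:ℝ)+2)) Filter.atTop (nhds 0) := by
    have := (Filter.tendsto_add_atTop_iff_nat 1).2 (tendsto_one_div_add_atTop_nhds_zero_nat (𝕜 := ℝ))
    refine this.congr fun n => ?_
    push_cast; ring_nf
  have h1 := h0.rpow_const (p := H) (Or.inr hH.1.le)
  have h2 := h0.rpow_const (p := 1 - H) (Or.inr (by linarith [hH.2]))
  have h3 := h1.add h2
  rw [Real.zero_rpow hH.1.ne', Real.zero_rpow (by linarith [hH.2]), add_zero] at h3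
  obtain ⟨k, hk⟩ := (h3.eventually (gt_mem_nhds hε)).exists
  exact ⟨k, hk.le⟩

lemma fixed_time {Ω : Type*} [MeasurableSpace Ω] (P : Measure Ω) [IsProbabilityMeasure P]
    (H T : ℝ) (hH : H ∈ Set.Ioo (0:ℝ) 1)
    (B : ℝ → Ω → ℝ) (hB : IsFractionalBrownianMotion P H T B) (t : ℝ) (ht : t ∈ Set.Ioc 0 T) :
    P {ω | ∀ k n : ℕ, B (t - (1/((k:ℝ)+2))^n * t) ω ≤ B t ω} = 0 := by
  obtain ⟨-, hm, -, hG, hC⟩ := hB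
  have hmem : ∀ s, 0 ≤ s → s ≤ t → t - s ∈ Set.Icc 0 T := fun s h1 h2 => ⟨by linarith, by linarith [ht.2]⟩
  have htm : t ∈ Set.Icc 0 T := ⟨ht.1.le, ht.2⟩
  have hrt : ∀ k n : ℕ, 0 < (1/((k:ℝ)+2))^n * t ∧ (1/((k:ℝ)+2))^n * t ≤ t := by
    intro k n
    have : (1/((k:ℝ)+2)) ≤ 1 := by
      rw [div_le_one (by positivity)]; linarith [(Nat.cast_nonneg k : (0:ℝ) ≤ k)]
    have h2 : (1/((k:ℝ)+2))^n ≤ 1 := pow_le_one₀ (by positivity) this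
    have := ht.1
    exact ⟨by positivity, by nlinarith⟩
  have hmm : ∀ k n : ℕ, Measurable (B (t - (1/((k:ℝ)+2))^n * t)) := fun k n =>
    hm _ (hmem _ (hrt k n).1.le (hrt k n).2)
  have hL2 : ∀ s ∈ Set.Icc 0 T, MemLp (B s) 2 P := by
    intro s hs
    obtain ⟨v, hv⟩ := hG 1 (fun _ => 1) (fun _ => s) (fun _ => hs)
    simp only [Finset.univ_unique, Finset.sum_const, Finset.card_singleton, one_smul, one_mul] at hv
    have := memLp_id_gaussianReal (μ := 0) (v := v) 2
    rw [← hv] at this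
    exact (memLp_map_measure_iff (by fun_prop) (hm s hs).aemeasurable).1 this
  have hH2 : 2 * H ≠ 0 := by have := hH.1; positivity
  have hcov : ∀ s u, 0 ≤ s → s ≤ t → 0 ≤ u → u ≤ t →
      ∫ ω, (B t ω - B (t-s) ω) * (B t ω - B (t-u) ω) ∂P = (1/2) * (s^(2*H) + u^(2*H) - |u-s|^(2*H)) := by
    intro s u hs0 hst hu0 hut
    have i1 : ∀ a ∈ Set.Icc 0 T, ∀ b ∈ Set.Icc 0 T, Integrable (fun ω => B a ω * B b ω) P :=
      fun a ha b hb => (hL2 a ha).integrable_mul (hL2 b hb)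
    have ms := hmem s hs0 hst
    have mu := hmem u hu0 hut
    have e : (fun ω => (B t ω - B (t-s) ω) * (B t ω - B (t-u) ω)) = fun ω =>
        (B t ω * B t ω - B t ω * B (t-u) ω) - (B (t-s) ω * B t ω - B (t-s) ω * B (t-u) ω) := by
      ext ω; ring
    have j1 : Integrable (fun ω => B t ω * B t ω - B t ω * B (t-u) ω) P := (i1 _ htm _ htm).sub (i1 _ htm _ mu)
    have j2 : Integrable (fun ω => B (t-s) ω * B t ω - B (t-s) ω * B (t-u) ω) P := (i1 _ ms _ htm).sub (i1 _ ms _ mu)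
    rw [e, integral_sub j1 j2,
      integral_sub (i1 _ htm _ htm) (i1 _ htm _ mu), integral_sub (i1 _ ms _ htm) (i1 _ ms _ mu),
      hC _ htm _ htm, hC _ htm _ mu, hC _ ms _ htm, hC _ ms _ mu]
    have a1 : |t - u - t| = u := by rw [show t - u - t = -u by ring, abs_neg, abs_of_nonneg hu0]
    have a2 : |t - (t - s)| = s := by rw [show t - (t - s) = s by ring, abs_of_nonneg hs0]
    have a3 : |t - u - (t - s)| = |u - s| := by rw [show t - u - (t - s) = -(u - s) by ring, abs_neg]
    rw [a1, a2, a3, sub_self, abs_zero, Real.zero_rpow hH2]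
    ring
  apply key_s7
  · rw [show {ω | ∀ k n : ℕ, B (t - (1/((k:ℝ)+2))^n * t) ω ≤ B t ω} = ⋂ k : ℕ, ⋂ n : ℕ, {ω | B (t - (1/((k:ℝ)+2))^n * t) ω ≤ B t ω} by
      ext; simp]
    exact MeasurableSet.iInter fun k => MeasurableSet.iInter fun n => measurableSet_le (hmm k n) (hm t htm)
  intro N hN
  obtain ⟨k, hk⟩ := exists_k H hH (1/(N:ℝ)) (by positivity)
  set r := 1/((k:ℝ)+2) with hr
  have hr0 : 0 < r := by positivity
  have hr1 : r < 1 := by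
    rw [hr, div_lt_one (by positivity)]; linarith [(Nat.cast_nonneg k : (0:ℝ) ≤ k)]
  have hs : ∀ n : ℕ, 0 < r^n*t ∧ r^n*t ≤ t := hrt k
  set Y : ℕ → Ω → ℝ := fun n ω => (r^n*t)^(-H) * (B t ω - B (t - r^n*t) ω) with hY
  have hYm : ∀ n, Measurable (Y n) := fun n => ((hm t htm).sub (hmm k n)).const_mul _
  have hYY : ∀ i j, ∫ ω, Y i ω * Y j ω ∂P = (r^i*t)^(-H) * (r^j*t)^(-H) *
      ((1/2) * ((r^i*t)^(2*H) + (r^j*t)^(2*H) - |r^j*t - r^i*t|^(2*H))) := by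
    intro i j
    rw [← hcov _ _ (hs i).1.le (hs i).2 (hs j).1.le (hs j).2, ← integral_const_mul]
    congr 1; ext ω; simp only [hY]; ring
  have hlt : ∀ i j, i < j → ∫ ω, Y j ω * Y i ω ∂P ≤ 1/(N:ℝ) := by
    intro i j hij
    rw [hYY]
    have e : r^j*t = r^(j-i) * (r^i*t) := by
      rw [← mul_assoc, ← pow_add]; congr 2; omega
    have hqr : r^(j-i) ≤ r := by
      calc r^(j-i) ≤ r^1 := pow_le_pow_of_le_one hr0.le hr1.le (by omega)
        _ = r := pow_one r
    have hsub : 0 ≤ r^i*t - r^(j-i)*(r^i*t) := by nlinarith [(hs i).1]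
    rw [e, abs_of_nonneg hsub]
    exact (corr_bound H hH (r^i*t) (r^(j-i)) r (hs i).1 (by positivity) hqr hr1).trans hk
  refine ⟨Y, hYm, ?_, ?_, ?_⟩
  · intro n
    obtain ⟨v, hv⟩ := hG 2 ![(r^n*t)^(-H), -(r^n*t)^(-H)] ![t, t - r^n*t] (by
      intro i; fin_cases i
      · exact htm
      · exact hmem _ (hs n).1.le (hs n).2)
    have e : (fun ω => ∑ i, ![(r^n*t)^(-H), -(r^n*t)^(-H)] i * B (![t, t - r^n*t] i) ω) = Y n := by
      ext ω; simp [Fin.sum_univ_two, hY]; ring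
    rw [e] at hv
    have h1 : ∫ x, x * x ∂(gaussianReal 0 v) = v := by
      have := variance_id_gaussianReal (μ := 0) (v := v)
      rw [variance_of_integral_eq_zero (by fun_prop) (by simp)] at this
      simpa [sq] using this
    rw [← hv, integral_map (hYm n).aemeasurable (by fun_prop), hYY, sub_self, abs_zero, Real.zero_rpow hH2,
      ← Real.rpow_add (hs n).1] at h1
    have h2 : (r^n*t)^(-H + -H) * (r^n*t)^(2*H) = 1 := by
      rw [← Real.rpow_add (hs n).1]; ring_nf; simp
    have hv1 : (v:ℝ) = 1 := by rw [← h1]; linarith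
    have : v = 1 := by exact_mod_cast hv1
    rw [hv, this]
  · intro i j hij
    rcases lt_or_gt_of_ne hij with h | h
    · have := hlt i j h
      simpa only [mul_comm] using this
    · exact hlt j i h
  · intro n ω hω
    exact mul_nonneg (Real.rpow_nonneg (hs n).1.le _) (sub_nonneg.2 (hω k n))

/-- Let `B` be a fractional Brownian motion with Hurst index `H ∈ (0,1)`
on `[0,T]` and let `M_t = max_{0 ≤ s ≤ t} B_s` be its running maximum.  Then for
`P`-almost every `ω` the set `E_ω = {t ∈ [0,T] : B_t(ω) = M_t(ω)}` has Lebesgue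
measure zero. -/
theorem fbm_contact_set_null
    {Ω : Type*} [MeasurableSpace Ω] (P : Measure Ω) [IsProbabilityMeasure P]
    (H T : ℝ) (hH : H ∈ Set.Ioo (0:ℝ) 1) (hT : 0 < T)
    (B : ℝ → Ω → ℝ) (hB : IsFractionalBrownianMotion P H T B) :
    ∀ᵐ ω ∂P, volume {t | t ∈ Set.Icc 0 T ∧ B t ω = runningMax B t ω} = 0 := by
  have hcont := hB.2.2.1
  have hm := hB.2.1
  obtain ⟨Z, hZsub, hZm, hZ0⟩ := exists_measurable_superset_of_null (ae_iff.1 hcont)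
  have hZc : ∀ ω, ω ∉ Z → ContinuousOn (fun t => B t ω) (Set.Icc 0 T) := by
    intro ω hω
    by_contra h
    exact hω (hZsub h)
  classical
  -- continuous, everywhere defined modification
  let X : ℝ → Ω → ℝ := fun t => Set.indicator Zᶜ (B (Set.projIcc 0 T hT.le t))
  have hXm : ∀ t, Measurable (X t) := fun t =>
    (hm _ (Set.projIcc 0 T hT.le t).2).indicator hZm.compl
  have hXc : ∀ ω, Continuous fun t => X t ω := by
    intro ω
    by_cases h : ω ∈ Z
    · have : (fun t => X t ω) = fun _ => 0 := by ext t; simp [X, h]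
      rw [this]; exact continuous_const
    · have : (fun t => X t ω) = fun t => B (Set.projIcc 0 T hT.le t) ω := by ext t; simp [X, h]
      rw [this]
      exact (continuousOn_iff_continuous_domRestrict.1 (hZc ω h)).comp continuous_projIcc
  have hXjm : Measurable (Function.uncurry X) := measurable_uncurry_of_continuous_of_measurable hXc hXm
  have hXB : ∀ t ∈ Set.Icc 0 T, ∀ ω, ω ∉ Z → X t ω = B t ω := by
    intro t ht ω hω
    simp [X, hω, Set.projIcc_of_mem hT.le ht]
  let p : ℝ → Ω → Prop := fun t ω =>
    ¬ (t ∈ Set.Ioc 0 T ∧ ∀ k n : ℕ, X (t - (1/((k:ℝ)+2))^n * t) ω ≤ X t ω)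
  have hpm : MeasurableSet {x : ℝ × Ω | p x.1 x.2} := by
    have : {x : ℝ × Ω | p x.1 x.2} = ((Prod.fst ⁻¹' Set.Ioc 0 T) ∩ ⋂ k : ℕ, ⋂ n : ℕ,
      {x : ℝ × Ω | X (x.1 - (1/((k:ℝ)+2))^n * x.1) x.2 ≤ X x.1 x.2})ᶜ := by
      ext x; simp [p]
    rw [this]
    refine ((measurable_fst measurableSet_Ioc).inter (MeasurableSet.iInter fun k => MeasurableSet.iInter fun n =>
      measurableSet_le ?_ hXjm)).compl
    exact hXjm.comp (f := fun x : ℝ × Ω => (x.1 - (1/((k:ℝ)+2))^n * x.1, x.2)) (by fun_prop)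
  have hsl : ∀ k n : ℕ, ∀ t, 0 ≤ t → 0 ≤ t - (1/((k:ℝ)+2))^n * t ∧ t - (1/((k:ℝ)+2))^n * t ≤ t := by
    intro k n t ht
    have : (1/((k:ℝ)+2)) ≤ 1 := by
      rw [div_le_one (by positivity)]; linarith [(Nat.cast_nonneg k : (0:ℝ) ≤ k)]
    have h2 : (1/((k:ℝ)+2))^n ≤ 1 := pow_le_one₀ (by positivity) this
    have h3 : 0 ≤ (1/((k:ℝ)+2))^n := by positivity
    constructor <;> nlinarith
  have hZae : ∀ᵐ ω ∂P, ω ∉ Z := measure_eq_zero_iff_ae_notMem.1 hZ0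
  have h1 : ∀ᵐ t ∂(volume : Measure ℝ), ∀ᵐ ω ∂P, p t ω := by
    refine Filter.Eventually.of_forall fun t => ?_
    by_cases ht : t ∈ Set.Ioc 0 T
    · have := measure_eq_zero_iff_ae_notMem.1 (fixed_time P H T hH B hB t ht)
      filter_upwards [this, hZae] with ω hω hz hp
      apply hω
      intro k n
      have := hp.2 k n
      have hs := hsl k n t ht.1.le
      rwa [hXB _ ⟨hs.1, hs.2.trans ht.2⟩ ω hz, hXB t ⟨ht.1.le, ht.2⟩ ω hz] at this
    · exact Filter.Eventually.of_forall fun ω h => ht h.1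
  have h2 := (Measure.ae_ae_comm hpm).1 h1
  filter_upwards [h2, hZae] with ω hω hz
  have h0 : ∀ᵐ t ∂(volume : Measure ℝ), t ≠ 0 := by simp [ae_iff]
  rw [measure_eq_zero_iff_ae_notMem]
  filter_upwards [hω, h0] with t hpt ht0 ⟨htm, hBt⟩
  have ht : 0 < t := lt_of_le_of_ne htm.1 (Ne.symm ht0)
  refine hpt ⟨⟨ht, htm.2⟩, fun k n => ?_⟩
  have hs := hsl k n t ht.le
  rw [hXB _ ⟨hs.1, hs.2.trans htm.2⟩ ω hz, hXB t htm ω hz, hBt]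
  refine le_csSup ?_ ⟨_, ⟨hs.1, hs.2⟩, rfl⟩
  exact (isCompact_Icc.image_of_continuousOn ((hZc ω hz).mono (Set.Icc_subset_Icc_right htm.2))).bddAbove
end

section
/- Let B be a fractional Brownian motion with Hurst index H ∈ (0,1) on [0,T], let M_t = max_{0≤s≤t} B_s, and let (π_n) be any sequence of partitions of [0,T] with mesh tending to 0. Then almost surely M_T ≠ B_0 + lim_{n→∞} Σ_{t_i^n ∈ π_n} 1_{{B_{t_{i−1}^n} = M_{t_{i−1}^n}}} (B_{t_i^n} − B_{t_{i−1}^n}); that is, the representation M_T = B_0 + ∫₀ᵀ 1_{{B_t = M_t}} dB_t fails almost surely when the integral is understood as the limit of these Riemann–Stieltjes sums (the limit equals 0 a.s. while P{M_T = 0} = 0). -/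
open MeasureTheory

lemma aux_memLp {Ω : Type*} [MeasurableSpace Ω] {P : Measure Ω}
    {X : Ω → ℝ} (hX : Measurable X) {v : NNReal}
    (h : P.map X = ProbabilityTheory.gaussianReal 0 v) : MemLp X 2 P := by
  have h1 : MemLp id 2 (P.map X) := by
    rw [h]; exact ProbabilityTheory.memLp_id_gaussianReal' 2 (by norm_num)
  exact (memLp_map_measure_iff (by fun_prop) hX.aemeasurable).1 h1

lemma aux_var {Ω : Type*} [MeasurableSpace Ω] {P : Measure Ω}
    {X : Ω → ℝ} (hX : Measurable X) {v : NNReal}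
    (h : P.map X = ProbabilityTheory.gaussianReal 0 v) (h1 : ∫ ω, X ω * X ω ∂P = 1) : v = 1 := by
  have h2 : ∫ x, x * x ∂(P.map X) = 1 := by
    rw [integral_map hX.aemeasurable (by fun_prop)]; exact h1
  have h3 := ProbabilityTheory.variance_fun_id_gaussianReal (μ := 0) (v := v)
  rw [ProbabilityTheory.variance_of_integral_eq_zero (by fun_prop) (by simp)] at h3
  rw [h] at h2
  simp only [sq] at h3
  rw [h3] at h2
  exact_mod_cast h2

lemma aux_zero {Ω : Type*} [MeasurableSpace Ω] (P : Measure Ω) [IsProbabilityMeasure P]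
    (A : Set Ω)
    (hA : ∀ ε > (0:ℝ), ∃ X : ℕ → Ω → ℝ, (∀ i, Measurable (X i)) ∧
      (∀ i, ∃ v : NNReal, P.map (X i) = ProbabilityTheory.gaussianReal 0 v) ∧
      (∀ i, ∫ ω, X i ω * X i ω ∂P = 1) ∧
      (∀ i j, i ≠ j → ∫ ω, X i ω * X j ω ∂P ≤ ε) ∧ ∀ ω ∈ A, ∀ i, X i ω ≤ 0) :
    P A = 0 := by
  suffices h : ∀ η > (0:ℝ), P.real A ≤ 3 * η by
    have h0 : P.real A ≤ 0 := by
      refine le_of_forall_pos_le_add fun ε hε => ?_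
      have := h (ε/3) (by positivity)
      linarith
    have := le_antisymm h0 measureReal_nonneg
    rwa [measureReal_eq_zero_iff] at this
  intro η hη
  -- choose δ
  obtain ⟨δ, hδ, hδη⟩ : ∃ δ > (0:ℝ),
      (ProbabilityTheory.gaussianReal 0 1).real (Set.Icc (0 - δ) (0 + δ)) ≤ η := by
    have : NullSingletonClass (ProbabilityTheory.gaussianReal 0 1) :=
      ProbabilityTheory.nullSingletonClass_gaussianReal one_ne_zero
    have ht := tendsto_measure_Icc (ProbabilityTheory.gaussianReal 0 1) 0
    have ht2 := ht.eventually (gt_mem_nhds (ENNReal.ofReal_pos.2 hη))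
    have ht3 := (ht2.filter_mono nhdsWithin_le_nhds : ∀ᶠ x in nhdsWithin (0:ℝ) (Set.Ioi 0), _)
    obtain ⟨δ, h1, h2⟩ := (ht3.and self_mem_nhdsWithin).exists
    refine ⟨δ, h2, ?_⟩
    rw [measureReal_def]
    exact ENNReal.toReal_le_of_le_ofReal hη.le h1.le
  obtain ⟨N, hN⟩ := exists_nat_gt (1 / (2 * η^2 * δ^2))
  have hN0 : (0:ℝ) < N := lt_trans (by positivity) hN
  obtain ⟨X, hXm, hXg, hXv, hXc, hXA⟩ := hA (2 * η^2 * δ^2) (by positivity)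
  have hX2 : ∀ i, MemLp (X i) 2 P := fun i => by
    obtain ⟨v, hv⟩ := hXg i; exact aux_memLp (hXm i) hv
  have hXl : ∀ i, P.map (X i) = ProbabilityTheory.gaussianReal 0 1 := fun i => by
    obtain ⟨v, hv⟩ := hXg i
    rw [hv, aux_var (hXm i) hv (hXv i)]
  set E : ℕ → Set Ω := fun i => X i ⁻¹' Set.Icc (0 - δ) (0 + δ) with hE
  have hEm : ∀ i, MeasurableSet (E i) := fun i => hXm i measurableSet_Icc
  have hEp : ∀ i, P.real (E i) ≤ η := fun i => by
    rw [← hXl i, measureReal_def, Measure.map_apply (hXm i) measurableSet_Icc] at hδη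
    exact hδη
  have hint : ∀ i j, Integrable (fun ω => X i ω * X j ω) P := fun i j =>
    (hX2 i).integrable_mul (hX2 j)
  set F1 : Ω → ℝ := fun ω => (∑ i ∈ Finset.range N, (E i).indicator (fun _ => (1:ℝ)) ω) / N
  set F2 : Ω → ℝ := fun ω =>
    (∑ i ∈ Finset.range N, ∑ j ∈ Finset.range N, X i ω * X j ω) / (4 * η * δ^2 * N^2)
  have hF2 : ∀ ω, F2 ω = (∑ i ∈ Finset.range N, X i ω)^2 / (4 * η * δ^2 * N^2) := fun ω => by
    simp only [F2]
    rw [sq (∑ i ∈ Finset.range N, X i ω), Finset.sum_mul_sum]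
  have i1 : Integrable F1 P := by
    refine Integrable.div_const (integrable_finsetSum _ fun i _ => ?_) _
    exact (integrable_const _).indicator (hEm i)
  have i2 : Integrable F2 P := by
    refine Integrable.div_const (integrable_finsetSum _ fun i _ => ?_) _
    exact integrable_finsetSum _ fun j _ => hint i j
  have e1 : ∫ ω, F1 ω ∂P ≤ η := by
    simp only [F1]
    rw [integral_div, integral_finsetSum _ (fun i _ => (integrable_const _).indicator (hEm i)),
      div_le_iff₀ hN0]
    calc _ ≤ ∑ i ∈ Finset.range N, η := Finset.sum_le_sum fun i _ => by
            rw [integral_indicator_const _ (hEm i)]; simpa using hEp i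
      _ = _ := by simp [mul_comm]
  have e2 : ∫ ω, F2 ω ∂P ≤ η := by
    simp only [F2]
    rw [integral_div, integral_finsetSum _ (fun i _ => integrable_finsetSum _ fun j _ => hint i j),
      div_le_iff₀ (by positivity)]
    calc _ ≤ ∑ i ∈ Finset.range N, ∑ j ∈ Finset.range N,
              ((if i = j then 1 else 0) + 2 * η^2 * δ^2) := Finset.sum_le_sum fun i _ => by
            rw [integral_finsetSum _ (fun j _ => hint i j)]
            refine Finset.sum_le_sum fun j _ => ?_
            split_ifs with hij
            · subst hij; rw [hXv]; have : 0 < 2 * η^2 * δ^2 := by positivity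
              linarith
            · simpa using hXc i j hij
      _ = N + N^2 * (2 * η^2 * δ^2) := by
            have h1 : ∀ i ∈ Finset.range N, ∑ j ∈ Finset.range N,
                ((if i = j then (1:ℝ) else 0) + 2 * η^2 * δ^2) = 1 + N * (2 * η^2 * δ^2) := by
              intro i hi
              rw [Finset.sum_add_distrib, Finset.sum_ite_eq, if_pos hi]; simp
            rw [Finset.sum_congr rfl h1]; simp; ring
      _ ≤ _ := by
            rw [div_lt_iff₀ (by positivity)] at hN
            nlinarith
  have hF1n : ∀ ω, 0 ≤ F1 ω := fun ω =>
    div_nonneg (Finset.sum_nonneg fun i _ => Set.indicator_nonneg (by simp) _) hN0.le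
  have hF2n : ∀ ω, 0 ≤ F2 ω := fun ω => by rw [hF2]; positivity
  have hm := mul_meas_ge_le_integral_of_nonneg (μ := P) (f := fun ω => F1 ω + F2 ω + η)
    (Filter.Eventually.of_forall fun ω => by
      have := hF1n ω; have := hF2n ω; simp only [Pi.zero_apply]; positivity)
    ((i1.add i2).add (integrable_const _)) 1
  have e3 : ∫ ω, (F1 ω + F2 ω + η) ∂P = ∫ ω, F1 ω ∂P + ∫ ω, F2 ω ∂P + η := by
    have h1 : Integrable (fun ω => F1 ω + F2 ω) P := i1.add i2
    rw [integral_add h1 (integrable_const _), integral_add i1 i2]; simp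
  have hsub : A ⊆ {ω | 1 ≤ F1 ω + F2 ω + η} := by
    intro ω hω
    have hx := hXA ω hω
    set S := ∑ i ∈ Finset.range N, X i ω with hS
    have a1 : (N:ℝ) ≤ (∑ i ∈ Finset.range N, (E i).indicator (fun _ => (1:ℝ)) ω) - S / δ := by
      have : ∑ i ∈ Finset.range N, (1:ℝ) ≤
          ∑ i ∈ Finset.range N, ((E i).indicator (fun _ => (1:ℝ)) ω - X i ω / δ) := by
        refine Finset.sum_le_sum fun i _ => ?_
        by_cases hi : ω ∈ E i
        · rw [Set.indicator_of_mem hi]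
          have : X i ω / δ ≤ 0 := div_nonpos_of_nonpos_of_nonneg (hx i) hδ.le
          linarith
        · rw [Set.indicator_of_notMem hi]
          have : X i ω < -δ := by
            by_contra hcon
            push Not at hcon
            exact hi ⟨by linarith, by have := hx i; linarith⟩
          have : X i ω / δ ≤ -1 := by rw [div_le_iff₀ hδ]; linarith
          linarith
      rw [Finset.sum_sub_distrib, ← Finset.sum_div] at this
      simpa using this
    have a2 : 1 ≤ F1 ω - S / (δ * N) := by
      have := div_le_div_of_nonneg_right a1 hN0.le
      rw [div_self hN0.ne', sub_div, div_div] at this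
      exact this
    have a3 : F2 ω + η + S / (δ * N) = (S / (δ * N) + 2 * η)^2 / (4 * η) := by
      rw [hF2, ← hS]; field_simp; ring
    have a4 : 0 ≤ (S / (δ * N) + 2 * η)^2 / (4 * η) := by positivity
    simp only [Set.mem_ofPred_eq]
    linarith
  have := measureReal_mono (μ := P) hsub (measure_ne_top _ _)
  linarith

lemma aux_rpow {H : ℝ} (hH : H ∈ Set.Ioo (0:ℝ) 1) {x : ℝ} (hx : 0 < x) (hx1 : x ≤ 1) :
    1 - 2 * x ≤ (1 - x) ^ (2*H) := by
  rcases eq_or_lt_of_le hx1 with h | h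
  · subst h; norm_num; exact (by positivity : (0:ℝ) ≤ 0 ^ (2*H)) |> fun h => by linarith
  · have := Real.rpow_le_rpow_of_exponent_ge (x := 1 - x) (y := 2) (z := 2*H) (by linarith) (by linarith)
      (by linarith [hH.2])
    norm_num at this
    nlinarith

/-- normalized covariance bound -/
lemma aux_cov {H : ℝ} (hH : H ∈ Set.Ioo (0:ℝ) 1) {u x r : ℝ} (hu : 0 < u) (hx : 0 < x)
    (hr : r ≤ 1) (hxr : x ≤ r) :
    (u ^ H)⁻¹ * ((u * x) ^ H)⁻¹ * ((1/2) * ((u*x) ^ (2*H) + u ^ (2*H) - (u - u*x) ^ (2*H)))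
      ≤ r ^ H + r ^ (1 - H) := by
  have hx1 : x ≤ 1 := hxr.trans hr
  have e : u - u * x = u * (1 - x) := by ring
  rw [e, Real.mul_rpow hu.le hx.le, Real.mul_rpow hu.le hx.le,
    Real.mul_rpow hu.le (by linarith : 0 ≤ 1 - x)]
  have hu2 : u ^ (2*H) = u ^ H * u ^ H := by rw [← Real.rpow_add hu]; ring_nf
  have hx2 : x ^ (2*H) = x ^ H * x ^ H := by rw [← Real.rpow_add hx]; ring_nf
  have hx3 : x ^ (1-H) * x ^ H = x := by rw [← Real.rpow_add hx]; simp
  have hb := aux_rpow hH hx hx1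
  have hm1 : x ^ H ≤ r ^ H := Real.rpow_le_rpow hx.le hxr hH.1.le
  have hm2 : x ^ (1-H) ≤ r ^ (1-H) := Real.rpow_le_rpow hx.le hxr (by linarith [hH.2])
  have pu : 0 < u ^ H := by positivity
  have px : 0 < x ^ H := by positivity
  refine le_trans ?_ (add_le_add hm1 hm2)
  rw [hu2, hx2]
  have : (u ^ H)⁻¹ * (u ^ H * x ^ H)⁻¹ * (1 / 2 * (u ^ H * u ^ H * (x ^ H * x ^ H) + u ^ H * u ^ H
      - u ^ H * u ^ H * (1 - x) ^ (2 * H))) = (1/2) * (x^H * x^H + 1 - (1-x)^(2*H)) / x^H := by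
    field_simp
  rw [this, div_le_iff₀ px]
  nlinarith

lemma aux_proc {Ω : Type*} [MeasurableSpace Ω] (P : Measure Ω) [IsProbabilityMeasure P]
    {H t : ℝ} (hH : H ∈ Set.Ioo (0:ℝ) 1) (ht : 0 < t) (Y : ℝ → Ω → ℝ)
    (hm : ∀ s ∈ Set.Icc 0 t, Measurable (Y s))
    (hg : ∀ s ∈ Set.Icc 0 t, ∀ c : ℝ, ∃ v : NNReal,
      P.map (fun ω => c * Y s ω) = ProbabilityTheory.gaussianReal 0 v)
    (hc : ∀ s ∈ Set.Icc 0 t, ∀ u ∈ Set.Icc 0 t,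
      ∫ ω, Y s ω * Y u ω ∂P = (1/2) * (u ^ (2*H) + s ^ (2*H) - |u - s| ^ (2*H))) :
    ∀ᵐ ω ∂P, ¬ ∀ s ∈ Set.Icc 0 t, Y s ω ≤ 0 := by
  rw [ae_iff]
  simp only [not_not]
  apply aux_zero
  intro ε hε
  obtain ⟨r, hr0, hr1, hrε⟩ : ∃ r > (0:ℝ), r ≤ 1 ∧ r ^ H + r ^ (1-H) ≤ ε := by
    have hcont : ContinuousAt (fun r : ℝ => r ^ H + r ^ (1-H)) 0 :=
      (Real.continuousAt_rpow_const _ _ (Or.inr hH.1.le)).add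
        (Real.continuousAt_rpow_const _ _ (Or.inr (by linarith [hH.2])))
    have h0 : (0:ℝ) ^ H + 0 ^ (1-H) < ε := by
      rw [Real.zero_rpow hH.1.ne', Real.zero_rpow (by linarith [hH.2])]; simpa
    have h1 := hcont.eventually (gt_mem_nhds h0)
    have h2 : ∀ᶠ x : ℝ in nhds 0, x < 1 := gt_mem_nhds one_pos
    have h3 := ((h1.and h2).filter_mono nhdsWithin_le_nhds :
      ∀ᶠ x in nhdsWithin (0:ℝ) (Set.Ioi 0), _)
    obtain ⟨r, ⟨a, b⟩, c⟩ := (h3.and self_mem_nhdsWithin).exists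
    exact ⟨r, c, b.le, a.le⟩
  have hp : ∀ i : ℕ, 0 < t * r ^ i := fun i => by positivity
  have hI : ∀ i : ℕ, t * r ^ i ∈ Set.Icc 0 t := fun i =>
    ⟨(hp i).le, mul_le_of_le_one_right ht.le (pow_le_one₀ hr0.le hr1)⟩
  have hprod : ∀ i j : ℕ, ∫ ω, (((t * r ^ i) ^ H)⁻¹ * Y (t * r ^ i) ω) *
      (((t * r ^ j) ^ H)⁻¹ * Y (t * r ^ j) ω) ∂P = ((t * r ^ i) ^ H)⁻¹ * ((t * r ^ j) ^ H)⁻¹ *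
      ((1/2) * ((t * r ^ j) ^ (2*H) + (t * r ^ i) ^ (2*H) - |t * r ^ j - t * r ^ i| ^ (2*H))) := by
    intro i j
    rw [← hc _ (hI i) _ (hI j), ← integral_const_mul]
    congr 1; ext ω; ring
  have hlt : ∀ i j : ℕ, i < j → ∫ ω, (((t * r ^ i) ^ H)⁻¹ * Y (t * r ^ i) ω) *
      (((t * r ^ j) ^ H)⁻¹ * Y (t * r ^ j) ω) ∂P ≤ ε := by
    intro i j hij
    rw [hprod]
    have e : t * r ^ j = t * r ^ i * r ^ (j - i) := by
      rw [mul_assoc, ← pow_add]; congr 2; omega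
    have hq : r ^ (j - i) ≤ r := pow_le_of_le_one hr0.le hr1 (by omega)
    rw [e, abs_sub_comm, abs_of_nonneg]
    · exact (aux_cov hH (hp i) (by positivity) hr1 hq).trans hrε
    · have := mul_le_of_le_one_right (hp i).le (hq.trans hr1)
      linarith
  refine ⟨fun i ω => ((t * r ^ i) ^ H)⁻¹ * Y (t * r ^ i) ω, fun i => (hm _ (hI i)).const_mul _,
    fun i => hg _ (hI i) _, ?_, ?_, ?_⟩
  · intro i
    rw [hprod]
    have h2 : (t * r ^ i) ^ (2*H) = (t * r ^ i) ^ H * (t * r ^ i) ^ H := by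
      rw [← Real.rpow_add (hp i)]; ring_nf
    have pu : 0 < (t * r ^ i) ^ H := Real.rpow_pos_of_pos (hp i) _
    rw [sub_self, abs_zero, Real.zero_rpow (by linarith [hH.1]), h2]
    field_simp
    ring
  · intro i j hij
    rcases lt_or_gt_of_ne hij with h | h
    · exact hlt i j h
    · have := hlt j i h
      simpa only [mul_comm] using this
  · intro ω hω i
    exact mul_nonpos_of_nonneg_of_nonpos (by positivity) (hω _ (hI i))

lemma aux_fbm {Ω : Type*} [MeasurableSpace Ω] (P : Measure Ω) [IsProbabilityMeasure P]
    {H T : ℝ} (hH : H ∈ Set.Ioo (0:ℝ) 1)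
    {B : ℝ → Ω → ℝ} (hB : IsFractionalBrownianMotion P H T B) {t : ℝ} (ht : 0 < t) (htT : t ≤ T) :
    (∀ᵐ ω ∂P, ¬ ∀ s ∈ Set.Icc 0 t, B s ω ≤ 0) ∧
    (∀ᵐ ω ∂P, ¬ ∀ s ∈ Set.Icc 0 t, B s ω ≤ B t ω) := by
  obtain ⟨h0, hm, -, hg, hc⟩ := hB
  have hsub : ∀ s ∈ Set.Icc 0 t, s ∈ Set.Icc 0 T := fun s hs => ⟨hs.1, hs.2.trans htT⟩
  have hg1 : ∀ s ∈ Set.Icc 0 T, ∀ c : ℝ, ∃ v : NNReal,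
      P.map (fun ω => c * B s ω) = ProbabilityTheory.gaussianReal 0 v := by
    intro s hs c
    obtain ⟨v, hv⟩ := hg 1 (fun _ => c) (fun _ => s) (fun _ => hs)
    exact ⟨v, by simpa using hv⟩
  have hL : ∀ s ∈ Set.Icc 0 T, MemLp (B s) 2 P := by
    intro s hs
    obtain ⟨v, hv⟩ := hg1 s hs 1
    simp only [one_mul] at hv
    exact aux_memLp (hm s hs) hv
  have hint : ∀ s ∈ Set.Icc 0 T, ∀ u ∈ Set.Icc 0 T, Integrable (fun ω => B s ω * B u ω) P :=
    fun s hs u hu => (hL s hs).integrable_mul (hL u hu)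
  have htI : t ∈ Set.Icc 0 T := ⟨ht.le, htT⟩
  constructor
  · exact aux_proc P hH ht B (fun s hs => hm s (hsub s hs)) (fun s hs => hg1 s (hsub s hs))
      (fun s hs u hu => hc s (hsub s hs) u (hsub u hu))
  · have hr : ∀ s ∈ Set.Icc 0 t, t - s ∈ Set.Icc 0 T := fun s hs =>
      ⟨by linarith [hs.2], by linarith [hs.1]⟩
    have := aux_proc P hH ht (fun s ω => B (t - s) ω - B t ω)
      (fun s hs => (hm _ (hr s hs)).sub (hm t htI)) ?_ ?_
    · filter_upwards [this] with ω hω hcon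
      refine hω fun s hs => ?_
      have := hcon (t - s) ⟨by linarith [hs.2], by linarith [hs.1]⟩
      linarith
    · intro s hs c
      obtain ⟨v, hv⟩ := hg 2 ![c, -c] ![t - s, t] (by
        intro i; fin_cases i
        · exact hr s hs
        · exact htI)
      refine ⟨v, ?_⟩
      rw [← hv]
      congr 1; ext ω; simp [Fin.sum_univ_two]; ring
    · intro s hs u hu
      have e : ∀ ω, (B (t - s) ω - B t ω) * (B (t - u) ω - B t ω) =
          B (t - s) ω * B (t - u) ω - B (t - s) ω * B t ω - B t ω * B (t - u) ω
            + B t ω * B t ω := fun ω => by ring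
      simp only [e]
      have j1 := hint _ (hr s hs) _ (hr u hu)
      have j2 := hint _ (hr s hs) _ htI
      have j3 := hint _ htI _ (hr u hu)
      have j4 := hint _ htI _ htI
      have j12 : Integrable (fun ω => B (t - s) ω * B (t - u) ω - B (t - s) ω * B t ω) P :=
        j1.sub j2
      have j123 : Integrable (fun ω => B (t - s) ω * B (t - u) ω - B (t - s) ω * B t ω
        - B t ω * B (t - u) ω) P := j12.sub j3
      rw [integral_add j123 j4, integral_sub j12 j3, integral_sub j1 j2,
        hc _ (hr s hs) _ (hr u hu), hc _ (hr s hs) _ htI, hc _ htI _ (hr u hu), hc _ htI _ htI]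
      have a1 : |t - u - (t - s)| = |u - s| := by rw [← abs_neg]; congr 1; ring
      have a2 : |t - (t - s)| = s := by rw [sub_sub_cancel, abs_of_nonneg hs.1]
      have a3 : |t - u - t| = u := by
        rw [abs_sub_comm, sub_sub_cancel, abs_of_nonneg hu.1]
      rw [a1, a2, a3, sub_self, abs_zero, Real.zero_rpow (by linarith [hH.1])]
      ring

/-- Let `B` be a fractional Brownian motion with Hurst index `H ∈ (0,1)`
on `[0,T]`, `M` its running maximum, and let `(πₙ)` be a sequence of partitions of
`[0,T]` with mesh tending to `0`.  Then almost surely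
`M_T ≠ B_0 + lim_n Σ_{i=1}^{k(n)} 1_{{B_{t_{i-1}ⁿ} = M_{t_{i-1}ⁿ}}} (B_{t_iⁿ} - B_{t_{i-1}ⁿ})`;
that is, the representation `M_T = B_0 + ∫₀ᵀ 1_{{B_t = M_t}} dB_t` fails almost surely when
the integral is understood as the limit of these Riemann–Stieltjes sums. -/
theorem fbm_maximum_representation_fails_riemann
    {Ω : Type*} [MeasurableSpace Ω] (P : Measure Ω) [IsProbabilityMeasure P]
    (H T : ℝ) (hH : H ∈ Set.Ioo (0:ℝ) 1) (hT : 0 < T)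
    (B : ℝ → Ω → ℝ) (hB : IsFractionalBrownianMotion P H T B)
    (k : ℕ → ℕ) (π : ℕ → ℕ → ℝ)
    (hk : ∀ n, 0 < k n)
    (hπ0 : ∀ n, π n 0 = 0) (hπT : ∀ n, π n (k n) = T)
    (hπmono : ∀ n, ∀ i < k n, π n i < π n (i+1))
    (hmesh : ∀ ε > (0:ℝ), ∃ N : ℕ, ∀ n ≥ N, ∀ i < k n, π n (i+1) - π n i < ε) :
    ∀ᵐ ω ∂P,
      ¬ Filter.Tendsto
          (fun n => ∑ i ∈ Finset.range (k n),
            (if B (π n i) ω = runningMax B (π n i) ω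
              then B (π n (i+1)) ω - B (π n i) ω else 0))
          Filter.atTop (nhds (runningMax B T ω - B 0 ω)) := by
  have hle : ∀ n, ∀ i ≤ k n, ∀ j ≤ i, π n j ≤ π n i := by
    intro n i
    induction i with
    | zero => intro _ j hj; rw [Nat.le_zero.1 hj]
    | succ i ih =>
      intro hi j hj
      rcases Nat.lt_or_ge j (i+1) with h | h
      · exact (ih (by omega) j (by omega)).trans (hπmono n i (by omega)).le
      · rw [le_antisymm hj h]
  have hpos : ∀ n i, 0 < i → i < k n → 0 < π n i ∧ π n i ≤ T := by
    intro n i h0 hi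
    constructor
    · have h1 := hπmono n 0 (hk n)
      rw [hπ0] at h1
      exact h1.trans_le (hle n i hi.le 1 h0)
    · rw [← hπT n]; exact hle n _ le_rfl i hi.le
  have hall : ∀ᵐ ω ∂P, ∀ n i, 0 < i → i < k n → ¬ ∀ s ∈ Set.Icc 0 (π n i), B s ω ≤ B (π n i) ω := by
    rw [ae_all_iff]; intro n
    rw [ae_all_iff]; intro i
    by_cases h0 : 0 < i
    · by_cases hi : i < k n
      · filter_upwards [(aux_fbm P hH hB (hpos n i h0 hi).1 (hpos n i h0 hi).2).2] with ω hω _ _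
        exact hω
      · exact Filter.Eventually.of_forall fun ω _ h => absurd h hi
    · exact Filter.Eventually.of_forall fun ω h => absurd h h0
  filter_upwards [hall, (aux_fbm P hH hB hT le_rfl).1, hB.2.2.1] with ω h1 h2 hcont hlim
  have hB0 := hB.1 ω
  have hmax : ∀ t ≤ T, ∀ s ∈ Set.Icc 0 t, B s ω ≤ runningMax B t ω := by
    intro t ht s hs
    refine le_csSup ?_ ⟨s, hs, rfl⟩
    exact (isCompact_Icc.image_of_continuousOn
      (hcont.mono (Set.Icc_subset_Icc_right ht))).bddAbove
  have hsum : ∀ n, ∑ i ∈ Finset.range (k n),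
            (if B (π n i) ω = runningMax B (π n i) ω
              then B (π n (i+1)) ω - B (π n i) ω else 0) = B (π n 1) ω := by
    intro n
    rw [Finset.sum_eq_single 0]
    · rw [hπ0, if_pos]
      · simp [hB0]
      · simp [runningMax]
    · intro i hi hi0
      have hi' := Finset.mem_range.1 hi
      rw [if_neg]
      intro hcon
      refine h1 n i (Nat.pos_of_ne_zero hi0) hi' fun s hs => ?_
      rw [hcon]
      exact hmax _ (hpos n i (Nat.pos_of_ne_zero hi0) hi').2 s hs
    · intro h; exact absurd (Finset.mem_range.2 (hk n)) h
  simp only [hsum] at hlim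
  have hπ1 : Filter.Tendsto (fun n => π n 1) Filter.atTop (nhdsWithin 0 (Set.Icc 0 T)) := by
    have hmem : ∀ n, π n 1 ∈ Set.Icc 0 T := fun n => by
      refine ⟨?_, ?_⟩
      · rw [← hπ0 n]; exact hle n 1 (hk n) 0 (by omega)
      · rw [← hπT n]; exact hle n _ le_rfl 1 (hk n)
    refine tendsto_nhdsWithin_iff.2 ⟨?_, Filter.Eventually.of_forall hmem⟩
    rw [Metric.tendsto_atTop]
    intro ε hε
    obtain ⟨N, hN⟩ := hmesh ε hε
    refine ⟨N, fun n hn => ?_⟩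
    have := hN n hn 0 (hk n)
    rw [hπ0] at this
    rw [Real.dist_eq, sub_zero, abs_of_nonneg (hmem n).1]
    simpa using this
  have hl2 : Filter.Tendsto (fun n => B (π n 1) ω) Filter.atTop (nhds (B 0 ω)) :=
    (hcont 0 ⟨le_rfl, hT.le⟩).tendsto.comp hπ1
  have heq := tendsto_nhds_unique hlim hl2
  rw [hB0] at heq
  refine h2 fun s hs => ?_
  have := hmax T le_rfl s hs
  linarith
end

section
/- Let B be a fractional Brownian motion with Hurst index H > 1/2 on [0,T], let M_t = max_{0≤s≤t} B_s, and fix β ∈ (1 − H, 1/2). Then almost surely the function f(t) = 1_{{B_t = M_t}} satisfies ‖f‖_{2,β} = 0, and consequently the generalized Lebesgue–Stieltjes integral ∫₀ᵀ 1_{{B_t = M_t}} dB_t := ∫₀ᵀ (D_{0+}^β f)(x) (D_{T−}^{1−β} B_{T−})(x) dx exists and equals 0 almost surely. In particular, the representation M_T = B_0 + ∫₀ᵀ 1_{{B_t = M_t}} dB_t fails almost surely in the sense of generalized Lebesgue–Stieltjes integration. -/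
open MeasureTheory

/-- The fractional Besov-type seminorm
`‖f‖_{2,β} = ∫₀ᵀ |f(s)|/s^β ds + ∫₀ᵀ ∫₀ˢ |f(u) - f(s)|/(s - u)^{1+β} du ds`. -/
noncomputable def besovNorm2 (T β : ℝ) (f : ℝ → ℝ) : ENNReal :=
  (∫⁻ s in Set.Ioc (0:ℝ) T, ENNReal.ofReal (|f s| / s ^ β)) +
    ∫⁻ s in Set.Ioc (0:ℝ) T,
      ∫⁻ u in Set.Ioo (0:ℝ) s, ENNReal.ofReal (|f u - f s| / (s - u) ^ (1 + β))

/-- Left-sided Weyl fractional derivative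
`(D_{0+}^β f)(x) = (1/Γ(1-β)) (f(x)/x^β + β ∫₀ˣ (f(x) - f(y))/(x-y)^{β+1} dy)`. -/
noncomputable def weylLeft (β : ℝ) (f : ℝ → ℝ) (x : ℝ) : ℝ :=
  (1 / Real.Gamma (1 - β)) *
    (f x / x ^ β + β * ∫ y in Set.Ioo 0 x, (f x - f y) / (x - y) ^ (β + 1))

/-- Right-sided Weyl fractional derivative of `g_{T-} = g - g(T)`:
`(D_{T-}^{1-β} g_{T-})(x) = (1/Γ(β)) ((g(x)-g(T))/(T-x)^{1-β}
  + (1-β) ∫ₓᵀ (g(x)-g(y))/(y-x)^{2-β} dy)`. -/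
noncomputable def weylRight (β T : ℝ) (g : ℝ → ℝ) (x : ℝ) : ℝ :=
  (1 / Real.Gamma β) *
    ((g x - g T) / (T - x) ^ (1 - β) +
      (1 - β) * ∫ y in Set.Ioo x T, (g x - g y) / (y - x) ^ (2 - β))

open ProbabilityTheory

lemma aux_gauss_small_s11 (δ : ℝ) :
    gaussianReal 0 1 (Set.Ioc (-δ) 0) ≤ ENNReal.ofReal δ := by
  rw [gaussianReal_apply 0 (by norm_num)]
  calc ∫⁻ x in Set.Ioc (-δ) 0, gaussianPDF 0 1 x
      ≤ ∫⁻ x in Set.Ioc (-δ) 0, 1 := by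
        apply lintegral_mono
        intro x
        simp only [gaussianPDF, gaussianPDFReal]
        rw [ENNReal.ofReal_le_one]
        apply mul_le_one₀
        · apply inv_le_one_of_one_le₀
          rw [Real.one_le_sqrt]
          have := Real.pi_gt_three
          simp only [NNReal.coe_one]
          linarith
        · positivity
        · rw [Real.exp_le_one_iff]
          have : 0 ≤ (x-0)^2 := by positivity
          simp only [NNReal.coe_one]
          linarith
    _ = ENNReal.ofReal δ := by simp

lemma aux_core {Ω : Type*} [MeasurableSpace Ω] (P : Measure Ω) [IsProbabilityMeasure P]
    (n : ℕ) (hn : 0 < n) (X : ℕ → Ω → ℝ) (hX : ∀ i < n, Measurable (X i))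
    (hlaw : ∀ i < n, P.map (X i) = gaussianReal 0 1)
    (ε : ℝ) (hε : 0 ≤ ε) (hcov : ∀ i < n, ∀ j < n, i ≠ j → ∫ ω, X i ω * X j ω ∂P ≤ ε)
    (δ η : ℝ) (hδ : 0 < δ) (hη : 0 < η) :
    δ * (P.real {ω | ∀ i < n, X i ω ≤ 0} - δ) ≤ ((1 / n + ε) / η + η) / 2 := by
  set A := {ω | ∀ i < n, X i ω ≤ 0} with hA
  have hAm : MeasurableSet A := by
    have : A = ⋂ i, ⋂ (h : i < n), {ω | X i ω ≤ 0} := by ext; simp [hA]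
    rw [this]
    exact MeasurableSet.iInter fun i => MeasurableSet.iInter fun h =>
      measurableSet_le (hX i h) measurable_const
  have hL2 : ∀ i < n, MemLp (X i) 2 P := by
    intro i hi
    have h : MemLp id 2 (P.map (X i)) := by rw [hlaw i hi]; exact memLp_id_gaussianReal 2
    exact (memLp_map_measure_iff aestronglyMeasurable_id (hX i hi).aemeasurable).1 h
  have hint : ∀ i < n, ∀ j < n, Integrable (fun ω => X i ω * X j ω) P :=
    fun i hi j hj => (hL2 i hi).integrable_mul (hL2 j hj)
  have hvar : ∀ i < n, ∫ ω, X i ω * X i ω ∂P = 1 := by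
    intro i hi
    have h1 : ∫ ω, X i ω * X i ω ∂P = ∫ x, x * x ∂(P.map (X i)) :=
      (integral_map (f := fun x : ℝ => x * x) (hX i hi).aemeasurable (by fun_prop)).symm
    have h2 := variance_id_gaussianReal (μ := 0) (v := 1)
    rw [variance_eq_integral (by fun_prop)] at h2
    rw [h1, hlaw i hi]
    simpa [pow_two] using h2
  let E : ℕ → Set Ω := fun i => X i ⁻¹' Set.Ioc (-δ) 0
  have hEm : ∀ i < n, MeasurableSet (E i) := fun i hi => hX i hi measurableSet_Ioc
  have hEP : ∀ i < n, P.real (E i) ≤ δ := by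
    intro i hi
    have : P (E i) ≤ ENNReal.ofReal δ := by
      rw [← Measure.map_apply (hX i hi) measurableSet_Ioc, hlaw i hi]
      exact aux_gauss_small_s11 δ
    exact ENNReal.toReal_le_of_le_ofReal hδ.le this
  have hn' : (0:ℝ) < n := by exact_mod_cast hn
  -- pointwise
  have hpt : ∀ ω, n * δ * A.indicator 1 ω - δ * ∑ i ∈ Finset.range n, (E i).indicator 1 ω ≤
      n * (((∑ i ∈ Finset.range n, X i ω) * (∑ i ∈ Finset.range n, X i ω) / n ^ 2 / η + η) / 2) := by
    intro ω
    set S := ∑ i ∈ Finset.range n, X i ω with hS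
    have hq : |S| / n ≤ (S * S / n ^ 2 / η + η) / 2 := by
      have h0 : S * S / n^2 = (|S| / n)^2 := by rw [div_pow, sq_abs]; ring
      rw [h0]
      set y := |S| / n
      have : (y^2/η + η)/2 - y = (y-η)^2/(2*η) := by field_simp; ring
      have h3 : 0 ≤ (y-η)^2/(2*η) := by positivity
      linarith
    have h1 : n * δ * A.indicator 1 ω - δ * ∑ i ∈ Finset.range n, (E i).indicator 1 ω ≤ |S| := by
      by_cases hω : ω ∈ A
      · refine le_trans ?_ (neg_le_abs S)
        rw [hS, ← Finset.sum_neg_distrib, Finset.mul_sum]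
        have : n * δ * A.indicator 1 ω = ∑ i ∈ Finset.range n, δ := by simp [hω]
        rw [this, ← Finset.sum_sub_distrib]
        apply Finset.sum_le_sum
        intro i hi
        have hi' := hω i (Finset.mem_range.1 hi)
        by_cases h : ω ∈ E i
        · simp [h, hi']
        · have : X i ω ≤ -δ := by
            by_contra h'
            exact h ⟨not_le.1 h', hi'⟩
          simp [h]; linarith
      · have h4 : 0 ≤ ∑ i ∈ Finset.range n, (E i).indicator (1 : Ω → ℝ) ω :=
          Finset.sum_nonneg fun i _ => Set.indicator_nonneg (fun _ _ => zero_le_one) _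
        have h5 := mul_nonneg hδ.le h4
        have := abs_nonneg S
        simp only [Set.indicator_of_notMem hω]
        linarith
    have h2 : |S| = n * (|S| / n) := by field_simp
    rw [h2] at h1
    exact h1.trans (mul_le_mul_of_nonneg_left hq hn'.le)
  have hSS : ∀ ω, (∑ i ∈ Finset.range n, X i ω) * (∑ i ∈ Finset.range n, X i ω)
      = ∑ i ∈ Finset.range n, ∑ j ∈ Finset.range n, X i ω * X j ω := by
    intro ω; rw [Finset.sum_mul_sum]
  have hSSi : Integrable (fun ω => (∑ i ∈ Finset.range n, X i ω) * (∑ i ∈ Finset.range n, X i ω)) P := by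
    simp_rw [hSS]
    exact integrable_finsetSum _ fun i hi => integrable_finsetSum _ fun j hj =>
      hint i (Finset.mem_range.1 hi) j (Finset.mem_range.1 hj)
  have hSSb : ∫ ω, (∑ i ∈ Finset.range n, X i ω) * (∑ i ∈ Finset.range n, X i ω) ∂P
      ≤ n + n^2 * ε := by
    simp_rw [hSS]
    rw [integral_finsetSum _ fun i hi => integrable_finsetSum _ fun j hj =>
      hint i (Finset.mem_range.1 hi) j (Finset.mem_range.1 hj)]
    have : (n:ℝ) + n^2 * ε = ∑ i ∈ Finset.range n, ∑ j ∈ Finset.range n,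
        ((if i = j then (1:ℝ) else 0) + ε) := by
      simp only [Finset.sum_add_distrib, Finset.sum_ite_eq]
      simp only [Finset.sum_const, Finset.card_range, nsmul_eq_mul]
      rw [Finset.sum_congr rfl (g := fun _ => (1:ℝ)) (by intro x hx; simp [Finset.mem_range.1 hx])]
      simp; ring
    rw [this]
    apply Finset.sum_le_sum
    intro i hi
    have hi := Finset.mem_range.1 hi
    rw [integral_finsetSum _ fun j hj => hint i hi j (Finset.mem_range.1 hj)]
    apply Finset.sum_le_sum
    intro j hj
    have hj := Finset.mem_range.1 hj
    by_cases h : i = j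
    · subst h; rw [hvar i hi]; simp [hε]
    · simp [h, hcov i hi j hj h]
  have hAi : Integrable (A.indicator (1 : Ω → ℝ)) P :=
    (integrable_indicator_iff hAm).2 (integrable_const (1:ℝ)).integrableOn
  have hEi : ∀ i ∈ Finset.range n, Integrable ((E i).indicator (1 : Ω → ℝ)) P := fun i hi =>
    (integrable_indicator_iff (hEm i (Finset.mem_range.1 hi))).2 (integrable_const (1:ℝ)).integrableOn
  have hl : ∫ ω, (n * δ * A.indicator 1 ω - δ * ∑ i ∈ Finset.range n, (E i).indicator 1 ω) ∂P
      = n * δ * P.real A - δ * ∑ i ∈ Finset.range n, P.real (E i) := by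
    rw [integral_sub (hAi.const_mul _) ((integrable_finsetSum _ hEi).const_mul _),
      integral_const_mul, integral_const_mul, integral_finsetSum _ hEi, integral_indicator_one hAm]
    congr 2
    exact Finset.sum_congr rfl fun i hi => integral_indicator_one (hEm i (Finset.mem_range.1 hi))
  have hmono := integral_mono ((hAi.const_mul (n*δ)).sub ((integrable_finsetSum _ hEi).const_mul δ))
    (((((hSSi.div_const (n^2)).div_const η).add (integrable_const η)).div_const 2).const_mul (n:ℝ)) hpt
  have hr : ∫ ω, n * (((∑ i ∈ Finset.range n, X i ω) * (∑ i ∈ Finset.range n, X i ω) / n ^ 2 / η + η) / 2) ∂P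
     = n * (((∫ ω, (∑ i ∈ Finset.range n, X i ω) * (∑ i ∈ Finset.range n, X i ω) ∂P) / n ^ 2 / η + η) / 2) := by
    rw [integral_const_mul, integral_div, integral_add ((hSSi.div_const (n^2)).div_const η) (integrable_const η),
      integral_div, integral_div]
    simp
  have hm2 : n * δ * P.real A - δ * ∑ i ∈ Finset.range n, P.real (E i) ≤
     n * (((∫ ω, (∑ i ∈ Finset.range n, X i ω) * (∑ i ∈ Finset.range n, X i ω) ∂P) / n ^ 2 / η + η) / 2) := by
    rw [← hl, ← hr]; exact hmono
  have hsum : ∑ i ∈ Finset.range n, P.real (E i) ≤ n * δ := by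
    calc _ ≤ ∑ i ∈ Finset.range n, δ := Finset.sum_le_sum fun i hi => hEP i (Finset.mem_range.1 hi)
      _ = _ := by simp
  have h6 : (∫ ω, (∑ i ∈ Finset.range n, X i ω) * (∑ i ∈ Finset.range n, X i ω) ∂P) / n ^ 2 ≤ 1 / n + ε := by
    rw [div_le_iff₀ (by positivity)]
    refine hSSb.trans (le_of_eq ?_)
    field_simp
  have h7 : n * (δ * (P.real A - δ)) ≤ n * (((1 / n + ε) / η + η) / 2) := by
    calc n * (δ * (P.real A - δ)) ≤ n * δ * P.real A - δ * ∑ i ∈ Finset.range n, P.real (E i) := by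
          nlinarith [mul_le_mul_of_nonneg_left hsum hδ.le]
      _ ≤ _ := hm2
      _ ≤ _ := by gcongr
  exact le_of_mul_le_mul_left h7 hn'

lemma aux_cov_s11 {H s u : ℝ} (hH : H ∈ Set.Ioo (1/2 : ℝ) 1) (hs : 0 < s) (hsu : s ≤ u) :
    (1/2) * (u ^ (2*H) + s ^ (2*H) - |u - s| ^ (2*H)) / (s ^ H * u ^ H)
      ≤ 2 * (s / u) ^ (1 - H) := by
  obtain ⟨h1, h2⟩ := hH
  have hu : 0 < u := hs.trans_le hsu
  obtain ⟨x, rfl⟩ : ∃ x, s = x * u := ⟨s / u, by field_simp⟩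
  have hx : 0 < x := by by_contra h; nlinarith
  have hx1 : x ≤ 1 := by by_contra h; nlinarith
  have hab : |u - x * u| = (1 - x) * u := by
    rw [abs_of_nonneg (by linarith)]; ring
  rw [hab, mul_div_cancel_right₀ _ hu.ne', Real.mul_rpow hx.le hu.le,
    Real.mul_rpow (by linarith) hu.le, Real.mul_rpow hx.le hu.le, div_le_iff₀ (by positivity)]
  have e1 : u ^ (2*H) = u^H * u^H := by rw [← Real.rpow_add hu]; ring_nf
  have e2 : x ^ (1-H) * x^H = x := by rw [← Real.rpow_add hx]; simp
  have e3 : x ^ (2*H) ≤ x := by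
    calc x ^ (2*H) ≤ x ^ (1:ℝ) := Real.rpow_le_rpow_of_exponent_ge hx hx1 (by linarith)
      _ = x := Real.rpow_one x
  have e4 : 1 + (2*H) * (-x) ≤ (1 + (-x)) ^ (2*H) :=
    one_add_mul_self_le_rpow_one_add (by linarith) (by linarith)
  rw [← sub_eq_add_neg] at e4
  have : 2 * x ^ (1 - H) * (x ^ H * u ^ H * u ^ H) = 2 * x * u ^ (2*H) := by
    rw [e1]; linear_combination 2 * u^H * u^H * e2
  rw [this]
  have : 0 < u ^ (2*H) := by positivity
  have h5 : (1/2) * (1 + x ^ (2*H) - (1-x)^(2*H)) ≤ 2 * x := by nlinarith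
  nlinarith

lemma aux_zero_s11 {Ω : Type*} [MeasurableSpace Ω] (P : Measure Ω) [IsProbabilityMeasure P]
    {H t : ℝ} (hH : H ∈ Set.Ioo (1/2 : ℝ) 1) (ht : 0 < t) (Y : ℝ → Ω → ℝ)
    (hm : ∀ s ∈ Set.Ioc 0 t, Measurable (Y s))
    (hg : ∀ s ∈ Set.Ioc 0 t, ∃ v : NNReal, P.map (Y s) = gaussianReal 0 v)
    (hc : ∀ s ∈ Set.Ioc 0 t, ∀ u ∈ Set.Ioc 0 t,
      ∫ ω, Y s ω * Y u ω ∂P = (1/2) * (u ^ (2*H) + s ^ (2*H) - |u - s| ^ (2*H)))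
    (A : Set Ω) (hA : ∀ ω ∈ A, ∀ m k : ℕ, 0 < m → Y (t * (1 / m) ^ k) ω ≤ 0) : P A = 0 := by
  have key : ∀ δ : ℝ, 0 < δ → P.real A ≤ 2 * δ := by
    intro δ hδ
    obtain ⟨n, hn⟩ := exists_nat_gt (2 / δ^4)
    have hn' : (0:ℝ) < n := lt_trans (by positivity) hn
    have hn0 : 0 < n := by exact_mod_cast hn'
    have hlim : Filter.Tendsto (fun m : ℕ => 2 * ((1:ℝ) / m) ^ (1 - H)) Filter.atTop (nhds 0) := by
      have h1 := tendsto_one_div_atTop_nhds_zero_nat (𝕜 := ℝ)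
      have h2 := (h1.rpow_const (p := 1 - H) (Or.inr (by linarith [hH.2]))).const_mul 2
      rwa [Real.zero_rpow (by linarith [hH.2]), mul_zero] at h2
    obtain ⟨m, hm1, hm2⟩ := ((hlim.eventually (gt_mem_nhds (show (0:ℝ) < 1 / n by positivity))).and
      (Filter.eventually_ge_atTop 1)).exists
    have hmr : (1:ℝ) ≤ m := by exact_mod_cast hm2
    have hr0 : (0:ℝ) < 1 / m := by positivity
    have hr1 : (1:ℝ) / m ≤ 1 := by rw [div_le_one (by positivity)]; exact hmr
    set r : ℝ := 1 / m with hr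
    have hmem : ∀ k : ℕ, t * r ^ k ∈ Set.Ioc 0 t := fun k =>
      ⟨by positivity, mul_le_of_le_one_right ht.le (pow_le_one₀ hr0.le hr1)⟩
    have hcov : ∀ i j : ℕ, i < j → ∫ ω, (((t * r ^ i) ^ H)⁻¹ * Y (t * r ^ i) ω) *
        (((t * r ^ j) ^ H)⁻¹ * Y (t * r ^ j) ω) ∂P ≤ 1 / n := by
      intro i j hij
      have e : ∀ ω, (((t * r ^ i) ^ H)⁻¹ * Y (t * r ^ i) ω) * (((t * r ^ j) ^ H)⁻¹ * Y (t * r ^ j) ω)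
        = (((t * r ^ j) ^ H) * ((t * r ^ i) ^ H))⁻¹ * (Y (t * r ^ j) ω * Y (t * r ^ i) ω) := by
        intro ω; rw [mul_inv]; ring
      simp_rw [e]
      rw [integral_const_mul, hc _ (hmem j) _ (hmem i), mul_comm, ← div_eq_mul_inv]
      have hle : t * r ^ j ≤ t * r ^ i :=
        mul_le_mul_of_nonneg_left (pow_le_pow_of_le_one hr0.le hr1 hij.le) ht.le
      refine (aux_cov_s11 hH (hmem j).1 hle).trans (le_trans ?_ hm1.le)
      have : t * r ^ j / (t * r ^ i) ≤ r := by
        rw [div_le_iff₀ (hmem i).1]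
        calc t * r ^ j ≤ t * r ^ (i+1) :=
              mul_le_mul_of_nonneg_left (pow_le_pow_of_le_one hr0.le hr1 hij) ht.le
          _ = _ := by ring
      have h0 : 0 ≤ t * r ^ j / (t * r ^ i) := (div_pos (hmem j).1 (hmem i).1).le
      exact mul_le_mul_of_nonneg_left (Real.rpow_le_rpow h0 this (by linarith [hH.2])) (by norm_num)
    have hcore := aux_core P n hn0 (fun k ω => ((t * r ^ k) ^ H)⁻¹ * Y (t * r ^ k) ω)
      (fun i _ => (hm _ (hmem i)).const_mul _)
      (by
        intro i _
        obtain ⟨v, hv⟩ := hg _ (hmem i)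
        have hv1 : (v:ℝ) = (t * r ^ i) ^ (2*H) := by
          have h2 := variance_id_gaussianReal (μ := 0) (v := v)
          rw [variance_eq_integral (by fun_prop), ← hv] at h2
          rw [← h2, hv]
          simp only [id, integral_id_gaussianReal, sub_zero]
          rw [← hv, integral_map (hm _ (hmem i)).aemeasurable (by fun_prop)]
          have := hc _ (hmem i) _ (hmem i)
          simp only [pow_two]
          rw [this]
          rw [sub_self, abs_zero, Real.zero_rpow (by linarith [hH.1])]
          ring
        have h3 : P.map (fun ω => ((t * r ^ i) ^ H)⁻¹ * Y (t * r ^ i) ω)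
            = (P.map (Y (t * r ^ i))).map (((t * r ^ i) ^ H)⁻¹ * ·) := by
          rw [Measure.map_map (by fun_prop) (hm _ (hmem i))]; rfl
        rw [h3, hv, gaussianReal_map_const_mul]
        simp only [mul_zero]
        congr 1
        apply NNReal.coe_injective
        have hp : 0 < (t * r ^ i) ^ H := Real.rpow_pos_of_pos (hmem i).1 _
        simp only [NNReal.coe_mul, NNReal.coe_mk, NNReal.coe_one, hv1]
        have e1 : (t * r ^ i) ^ (2*H) = (t * r ^ i) ^ H * (t * r ^ i) ^ H := by
          rw [← Real.rpow_add (hmem i).1]; ring_nf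
        rw [e1]
        field_simp)
      (1 / n) (by positivity)
      (by
        intro i _ j _ hij
        rcases lt_or_gt_of_ne hij with h | h
        · exact hcov i j h
        · simp_rw [mul_comm (((t * r ^ i) ^ H)⁻¹ * Y (t * r ^ i) _)]
          exact hcov j i h)
      δ (δ^2) hδ (by positivity)
    have hsub : P.real A ≤ P.real {ω | ∀ i < n, ((t * r ^ i) ^ H)⁻¹ * Y (t * r ^ i) ω ≤ 0} := by
      refine measureReal_mono ?_ (measure_ne_top _ _)
      intro ω hω i _
      exact mul_nonpos_of_nonneg_of_nonpos (inv_nonneg.2 (Real.rpow_nonneg (hmem i).1.le _))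
        (hA ω hω m i hm2)
    have hb : (1 / (n:ℝ) + 1 / n) / δ^2 ≤ δ^2 := by
      rw [div_le_iff₀ (by positivity), ← add_div, div_le_iff₀ hn']
      rw [div_lt_iff₀ (by positivity)] at hn
      nlinarith
    have h9 : δ * (P.real A - δ) ≤ δ * δ := by
      calc _ ≤ _ := mul_le_mul_of_nonneg_left (sub_le_sub_right hsub δ) hδ.le
        _ ≤ _ := hcore
        _ ≤ _ := by nlinarith
    have := le_of_mul_le_mul_left h9 hδ
    linarith
  have h0 : P.real A ≤ 0 := by
    by_contra h
    have := key (P.real A / 4) (by linarith)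
    linarith
  have h1 : P.real A = 0 := le_antisymm h0 measureReal_nonneg
  rwa [measureReal_eq_zero_iff] at h1

/-- Let `B` be a fractional Brownian motion with Hurst index `H > 1/2`
on `[0,T]`, `M` its running maximum, and fix `β ∈ (1-H, 1/2)`.  Then almost surely the
function `f = 1_{{B = M}}` satisfies `‖f‖_{2,β} = 0`, the generalized Lebesgue–Stieltjes
integral `∫₀ᵀ 1_{{B_t = M_t}} dB_t := ∫₀ᵀ (D_{0+}^β f)(x) (D_{T-}^{1-β} B_{T-})(x) dx`
equals `0`, and the representation `M_T = B_0 + ∫₀ᵀ 1_{{B_t = M_t}} dB_t` fails. -/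
theorem fbm_maximum_representation_fails_gLS
    {Ω : Type*} [MeasurableSpace Ω] (P : Measure Ω) [IsProbabilityMeasure P]
    (H T : ℝ) (hH : H ∈ Set.Ioo (1/2 : ℝ) 1) (hT : 0 < T)
    (B : ℝ → Ω → ℝ) (hB : IsFractionalBrownianMotion P H T B)
    (β : ℝ) (hβ : β ∈ Set.Ioo (1 - H) (1/2 : ℝ)) :
    ∀ᵐ ω ∂P,
      besovNorm2 T β (fun t => if B t ω = runningMax B t ω then 1 else 0) = 0 ∧
      (∫ x in Set.Ioo (0:ℝ) T,
          weylLeft β (fun t => if B t ω = runningMax B t ω then 1 else 0) x *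
            weylRight β T (fun t => B t ω) x) = 0 ∧
      runningMax B T ω ≠
        B 0 ω + ∫ x in Set.Ioo (0:ℝ) T,
          weylLeft β (fun t => if B t ω = runningMax B t ω then 1 else 0) x *
            weylRight β T (fun t => B t ω) x := by
  
  obtain ⟨hB0, hBm, hBc, hBg, hBcov⟩ := hB
  have h0T : (0:ℝ) ∈ Set.Icc (0:ℝ) T := ⟨le_rfl, hT.le⟩
  have hH0 : 2 * H ≠ 0 := by linarith [hH.1]
  have hL2 : ∀ t ∈ Set.Icc (0:ℝ) T, MemLp (B t) 2 P := by
    intro t ht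
    obtain ⟨v, hv⟩ := hBg 1 (fun _ => 1) (fun _ => t) (fun _ => ht)
    simp only [one_mul, Finset.univ_unique, Finset.sum_singleton] at hv
    have h : MemLp id 2 (P.map (B t)) := by
      have : P.map (B t) = _ := hv
      rw [this]; exact memLp_id_gaussianReal 2
    exact (memLp_map_measure_iff aestronglyMeasurable_id (hBm t ht).aemeasurable).1 h
  have hint : ∀ s ∈ Set.Icc (0:ℝ) T, ∀ t ∈ Set.Icc (0:ℝ) T,
      Integrable (fun ω => B s ω * B t ω) P :=
    fun s hs t ht => (hL2 s hs).integrable_mul (hL2 t ht)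
  -- positivity of the maximum
  have hpos : ∀ᵐ ω ∂P, ¬ ∀ s ∈ Set.Icc (0:ℝ) T, B s ω ≤ 0 := by
    rw [ae_iff]
    refine aux_zero_s11 P hH hT B (fun s hs => hBm s ⟨hs.1.le, hs.2⟩) ?_
      (fun s hs u hu => hBcov s ⟨hs.1.le, hs.2⟩ u ⟨hu.1.le, hu.2⟩) _ ?_
    · intro s hs
      obtain ⟨v, hv⟩ := hBg 1 (fun _ => 1) (fun _ => s) (fun _ => ⟨hs.1.le, hs.2⟩)
      simp only [one_mul, Finset.univ_unique, Finset.sum_singleton] at hv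
      exact ⟨v, hv⟩
    · intro ω hω m k hm
      simp only [not_not, Set.mem_ofPred_eq] at hω
      have hm' : (1:ℝ) ≤ m := by exact_mod_cast hm
      have hr1 : (1:ℝ) / m ≤ 1 := by rw [div_le_one (by positivity)]; exact hm'
      exact hω _ ⟨by positivity, mul_le_of_le_one_right hT.le (pow_le_one₀ (by positivity) hr1)⟩
  -- at a fixed time, the process is a.s. not at its maximum
  have hfix : ∀ t ∈ Set.Ioc (0:ℝ) T, P {ω | ∀ q : ℚ, 0 ≤ q → q ≤ 1 → B (q * t) ω ≤ B t ω} = 0 := by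
    intro t ht
    have htI : t ∈ Set.Icc (0:ℝ) T := ⟨ht.1.le, ht.2⟩
    have hmem : ∀ s ∈ Set.Ioc 0 t, t - s ∈ Set.Icc (0:ℝ) T := fun s hs =>
      ⟨by linarith [hs.2], by linarith [hs.1, ht.2]⟩
    refine aux_zero_s11 P hH ht.1 (fun s ω => B (t - s) ω - B t ω)
      (fun s hs => (hBm _ (hmem s hs)).sub (hBm t htI)) ?_ ?_ _ ?_
    · intro s hs
      obtain ⟨v, hv⟩ := hBg 2 ![1, -1] ![t - s, t] (by
        intro i; fin_cases i
        · exact hmem s hs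
        · exact htI)
      refine ⟨v, ?_⟩
      rw [← hv]
      congr 1
      ext ω
      simp [Fin.sum_univ_two]
      ring
    · intro s hs u hu
      have e : ∀ ω, (B (t - s) ω - B t ω) * (B (t - u) ω - B t ω)
        = B (t - s) ω * B (t - u) ω - B (t - s) ω * B t ω - B t ω * B (t - u) ω + B t ω * B t ω := by
        intro ω; ring
      simp_rw [e]
      have i1 := hint _ (hmem s hs) _ (hmem u hu)
      have i2 := hint _ (hmem s hs) _ htI
      have i3 := hint _ htI _ (hmem u hu)
      have i4 := hint _ htI _ htI
      rw [integral_add (by exact (i1.sub i2).sub i3) i4, integral_sub (by exact i1.sub i2) i3, integral_sub i1 i2,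
        hBcov _ (hmem s hs) _ (hmem u hu), hBcov _ (hmem s hs) _ htI, hBcov _ htI _ (hmem u hu),
        hBcov _ htI _ htI]
      have a1 : |t - u - (t - s)| = |u - s| := by rw [abs_sub_comm]; congr 1; ring
      have a2 : |t - (t - s)| = s := by rw [sub_sub_cancel, abs_of_pos hs.1]
      have a3 : |t - u - t| = u := by rw [sub_sub_cancel_left, abs_neg, abs_of_pos hu.1]
      rw [a1, a2, a3, sub_self, abs_zero, Real.zero_rpow hH0]
      ring
    · intro ω hω m k hm
      have hm' : (1:ℚ) ≤ m := by exact_mod_cast hm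
      have hr1 : (1:ℚ) / m ≤ 1 := by rw [div_le_one (by positivity)]; exact hm'
      have hp1 : ((1:ℚ) / m) ^ k ≤ 1 := pow_le_one₀ (by positivity) hr1
      have hp0 : 0 ≤ ((1:ℚ) / m) ^ k := by positivity
      have h := hω (1 - (1 / m) ^ k) (by linarith) (by linarith)
      have e : ((1 - (1 / m) ^ k : ℚ) : ℝ) * t = t - t * (1 / m) ^ k := by push_cast; ring
      rw [e] at h
      show B (t - t * (1 / m) ^ k) ω - B t ω ≤ 0
      linarith
  -- a measurable null set off which paths are continuous
  obtain ⟨N, hNsub, hNm, hN0⟩ := exists_measurable_superset_of_null (ae_iff.1 hBc)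
  have hcont : ∀ ω ∉ N, ContinuousOn (fun t => B t ω) (Set.Icc 0 T) := by
    intro ω hω
    by_contra h
    exact hω (hNsub h)
  have hNae : ∀ᵐ ω ∂P, ω ∉ N := by rw [ae_iff]; simpa using hN0
  have hbdd : ∀ ω ∉ N, ∀ t ∈ Set.Icc (0:ℝ) T, BddAbove ((fun s => B s ω) '' Set.Icc 0 t) := by
    intro ω hω t ht
    exact (isCompact_Icc.image_of_continuousOn
      ((hcont ω hω).mono (Set.Icc_subset_Icc_right ht.2))).bddAbove
  let c : ℝ → ℝ := fun t => max 0 (min t T)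
  have hcI : ∀ t, c t ∈ Set.Icc (0:ℝ) T := fun t => ⟨le_max_left _ _, max_le hT.le (min_le_right _ _)⟩
  have hcid : ∀ t ∈ Set.Icc (0:ℝ) T, c t = t := fun t ht => by
    simp only [c]; rw [min_eq_left ht.2, max_eq_right ht.1]
  have hcc : Continuous c := by fun_prop
  let B' : ℝ → Ω → ℝ := fun t => Nᶜ.indicator (B (c t))
  have hB'm : ∀ t, Measurable (B' t) := fun t => (hBm _ (hcI t)).indicator hNm.compl
  have hB'c : ∀ ω, Continuous (fun t => B' t ω) := by
    intro ω
    by_cases hω : ω ∈ N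
    · simp only [B', Set.indicator, Set.mem_compl_iff, hω, not_true_eq_false, if_false]
      exact continuous_const
    · simp only [B', Set.indicator, Set.mem_compl_iff, hω, not_false_eq_true, if_true]
      exact (hcont ω hω).comp_continuous hcc hcI
  have hjoint : Measurable (fun p : Ω × ℝ => B' p.2 p.1) :=
    (measurable_uncurry_of_continuous_of_measurable (u := fun (ω : ℝ) (x : Ω) => B' ω x)
      hB'c hB'm).comp measurable_swap
  have hSm : MeasurableSet {p : Ω × ℝ | ¬ (∀ q : ℚ, 0 ≤ q → q ≤ 1 → B' (q * p.2) p.1 ≤ B' p.2 p.1)} := by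
    have : {p : Ω × ℝ | ∀ q : ℚ, 0 ≤ q → q ≤ 1 → B' (q * p.2) p.1 ≤ B' p.2 p.1} =
        ⋂ q : ℚ, ⋂ (_ : 0 ≤ q), ⋂ (_ : q ≤ 1), {p : Ω × ℝ | B' (q * p.2) p.1 ≤ B' p.2 p.1} := by
      ext; simp
    have h2 : MeasurableSet {p : Ω × ℝ | ∀ q : ℚ, 0 ≤ q → q ≤ 1 → B' (q * p.2) p.1 ≤ B' p.2 p.1} := by
      rw [this]
      refine MeasurableSet.iInter fun q => MeasurableSet.iInter fun _ => MeasurableSet.iInter fun _ => ?_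
      refine measurableSet_le ?_ hjoint
      exact hjoint.comp (measurable_fst.prodMk (measurable_snd.const_mul _))
    exact h2.compl
  have hae : ∀ᵐ ω ∂P, ∀ᵐ t ∂(volume.restrict (Set.Ioc 0 T)),
      ¬ (∀ q : ℚ, 0 ≤ q → q ≤ 1 → B' (q * t) ω ≤ B' t ω) := by
    rw [Measure.ae_ae_comm hSm]
    filter_upwards [ae_restrict_mem measurableSet_Ioc] with t ht
    have h1 : ∀ᵐ ω ∂P, ¬ (∀ q : ℚ, 0 ≤ q → q ≤ 1 → B (q * t) ω ≤ B t ω) := by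
      rw [ae_iff]; simpa only [not_not] using hfix t ht
    filter_upwards [h1, hNae] with ω hω hωN h
    apply hω
    intro q hq0 hq1
    have hq0' : (0:ℝ) ≤ q := by exact_mod_cast hq0
    have hq1' : (q:ℝ) ≤ 1 := by exact_mod_cast hq1
    have h := h q hq0 hq1
    simp only [B', Set.indicator, Set.mem_compl_iff, hωN, not_false_eq_true, if_true] at h
    rwa [hcid t ⟨ht.1.le, ht.2⟩, hcid (q * t) ⟨mul_nonneg hq0' ht.1.le,
      (mul_le_of_le_one_left ht.1.le hq1').trans ht.2⟩] at h
  filter_upwards [hae, hNae, hpos] with ω hω hωN hωp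
  set f : ℝ → ℝ := fun t => if B t ω = runningMax B t ω then 1 else 0 with hf
  have hf0 : ∀ᵐ t ∂(volume.restrict (Set.Ioc 0 T)), f t = 0 := by
    filter_upwards [hω, ae_restrict_mem measurableSet_Ioc] with t h ht
    simp only [hf]
    rw [if_neg]
    intro hmax
    apply h
    intro q hq0 hq1
    have hq0' : (0:ℝ) ≤ q := by exact_mod_cast hq0
    have hq1' : (q:ℝ) ≤ 1 := by exact_mod_cast hq1
    have hqt : (q:ℝ) * t ≤ t := mul_le_of_le_one_left ht.1.le hq1'
    simp only [B', Set.indicator, Set.mem_compl_iff, hωN, not_false_eq_true, if_true]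
    rw [hcid t ⟨ht.1.le, ht.2⟩, hcid (q * t) ⟨mul_nonneg hq0' ht.1.le, hqt.trans ht.2⟩, hmax]
    exact le_csSup (hbdd ω hωN t ⟨ht.1.le, ht.2⟩) ⟨q * t, ⟨mul_nonneg hq0' ht.1.le, hqt⟩, rfl⟩
  have hf0' : ∀ x ≤ T, ∀ᵐ t ∂(volume.restrict (Set.Ioo 0 x)), f t = 0 := fun x hx =>
    ae_restrict_of_ae_restrict_of_subset
      (Set.Ioo_subset_Ioc_self.trans (Set.Ioc_subset_Ioc_right hx)) hf0
  have hInt : (∫ x in Set.Ioo (0:ℝ) T, weylLeft β f x * weylRight β T (fun t => B t ω) x) = 0 := by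
    apply integral_eq_zero_of_ae
    filter_upwards [hf0' T le_rfl, ae_restrict_mem measurableSet_Ioo] with x hx hxI
    have : ∫ y in Set.Ioo 0 x, (f x - f y) / (x - y) ^ (β + 1) = 0 := by
      apply integral_eq_zero_of_ae
      filter_upwards [hf0' x hxI.2.le] with y hy
      simp [hx, hy]
    simp only [weylLeft]
    rw [this, hx]
    simp
  refine ⟨?_, hInt, ?_⟩
  · unfold besovNorm2
    rw [add_eq_zero]
    constructor
    · rw [← lintegral_zero (μ := volume.restrict (Set.Ioc 0 T))]
      apply lintegral_congr_ae
      filter_upwards [hf0] with s hs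
      simp [hs]
    · rw [← lintegral_zero (μ := volume.restrict (Set.Ioc 0 T))]
      apply lintegral_congr_ae
      filter_upwards [hf0, ae_restrict_mem measurableSet_Ioc] with s hs hsI
      rw [← lintegral_zero (μ := volume.restrict (Set.Ioo 0 s))]
      apply lintegral_congr_ae
      filter_upwards [hf0' s hsI.2] with u hu
      simp [hs, hu]
  · rw [hInt, hB0, add_zero]
    intro h
    apply hωp
    intro s hs
    rw [← h]
    exact le_csSup (hbdd ω hωN T ⟨hT.le, le_rfl⟩) ⟨s, hs, rfl⟩
end
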